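/- arXiv:2211.01464 — 2 statements merged into one kernel-verified Lean document; each statement's English description precedes it below -/
import Mathlib

section
/- Suppose X = (X_t)_{t∈[0,T]} has almost surely continuous sample paths in ℝ^d and satisfies conditions (A1) and (A2) for some α ∈ (0, 1/d), θ ≥ 0 and ι ∈ [0,1]. Then there exist exponents β₁, β₂ > 0 and a version L̃ of the local time such that, almost surely, L̃ is jointly Hölder continuous in (x,t): for every compact set K ⊆ ℝ^d there is a random constant η = η(ω,K) < ∞ with |L̃(x,t) − L̃(y,s)| ≤ η ( ‖x − y‖^{β₁} + |t − s|^{β₂} ) for all x, y ∈ K and all s, t ∈ [0,T]. -/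
open MeasureTheory Filter Topology Set RealInnerProductSpace

noncomputable section

abbrev Ed (d : ℕ) := EuclideanSpace ℝ (Fin d)

/-- Condition (A1) of the paper: for every m, every collection of frequencies with nonzero
coordinates, every partition `0 = t₀ < t₁ < … < t_m < T` and every choice of exponents
`k_{j,l} ∈ {0,4}`, the characteristic function of the linear combination of increments
satisfies the stated bound. -/
def CondA1 {Ω : Type*} [MeasurableSpace Ω] {d : ℕ} (P : Measure Ω)
    (X : ℝ → Ω → Ed d) (T α θ : ℝ) : Prop :=
  ∃ C : ℝ, 0 < C ∧
    ∀ m : ℕ, 0 < m → ∀ ξ : Fin m → Ed d, (∀ j l, ξ j l ≠ 0) →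
      ∀ t : Fin (m + 1) → ℝ, StrictMono t → t 0 = 0 → t (Fin.last m) < T →
        ∀ k : Fin m → Fin d → ℕ, (∀ j l, k j l = 0 ∨ k j l = 4) →
          ‖∫ ω, Complex.exp (Complex.I * Complex.ofReal
              (∑ j, ⟪ξ j, X (t j.succ) ω - X (t j.castSucc) ω⟫)) ∂P‖ ≤
            C ^ m * (m : ℝ) ^ (α * θ * (m : ℝ)) *
              ∏ j, ∏ l, (|ξ j l| ^ (k j l))⁻¹ *
                ((t j.succ - t j.castSucc) ^ (α * (k j l : ℝ)))⁻¹

/-- Condition (A2) of the paper: moment bounds for the increments. -/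
def CondA2 {Ω : Type*} [MeasurableSpace Ω] {d : ℕ} (P : Measure Ω)
    (X : ℝ → Ω → Ed d) (T α ι : ℝ) : Prop :=
  ∃ C : ℝ, 0 < C ∧
    ∀ p : ℝ, 1 ≤ p → ∀ s t : ℝ, 0 ≤ s → s ≤ t → t ≤ T →
      ∫ ω, ‖X t ω - X s ω‖ ^ p ∂P ≤ C ^ p * p ^ (p * ι) * |t - s| ^ (p * α)

/-- `L` is an occupation density (local time) of the path `u ↦ X u ω` on `[0,T]`:
for every Borel `B ⊆ [0,T]` and Borel `A ⊆ ℝ^d`, the occupation measure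
`τ(A,B) = λ(B ∩ X⁻¹(A))` equals `∫_A L(x,B) dx`. -/
def IsOccDensity {Ω : Type*} [MeasurableSpace Ω] {d : ℕ}
    (X : ℝ → Ω → Ed d) (T : ℝ) (L : Ed d → Set ℝ → Ω → ℝ) (ω : Ω) : Prop :=
  ∀ B : Set ℝ, MeasurableSet B → B ⊆ Icc 0 T →
    ∀ A : Set (Ed d), MeasurableSet A →
      volume (B ∩ {u | X u ω ∈ A}) = ENNReal.ofReal (∫ x in A, L x B ω)

theorem lintegral_prod_tail_sum {E : Type*} [AddCommGroup E] [MeasureSpace E] [MeasurableAdd₂ E]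
    [SigmaFinite (volume : Measure E)] [(volume : Measure E).IsAddLeftInvariant]
    [(volume : Measure E).IsAddRightInvariant] :
    ∀ (m : ℕ) (h : Fin m → E → ENNReal), (∀ j, Measurable (h j)) →
      ∫⁻ u : Fin m → E, ∏ j, h j (∑ i ∈ Finset.Ici j, u i) = ∏ j, ∫⁻ x, h j x
  | 0, h, hh => by simp [volume_pi]
  | m + 1, h, hh => by
    have key : ∀ (x : E) (v : Fin m → E),
        ∏ j, h j (∑ i ∈ Finset.Ici j, (Fin.cons x v : Fin (m + 1) → E) i) =
          h 0 (x + ∑ i, v i) * ∏ j : Fin m, h j.succ (∑ i ∈ Finset.Ici j, v i) := by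
      intro x v
      rw [Fin.prod_univ_succ]
      congr 1
      · rw [show Finset.Ici (0 : Fin (m + 1)) = Finset.univ by ext; simp, Fin.sum_univ_succ]
        simp
      · refine Finset.prod_congr rfl fun j _ => ?_
        have : Finset.Ici j.succ = (Finset.Ici j).map (Fin.succEmb m) := by simp
        rw [this, Finset.sum_map]
        simp
    rw [← (volume_preserving_piFinSuccAbove (fun _ : Fin (m + 1) => E) 0).symm.lintegral_comp
      (by fun_prop), Measure.volume_eq_prod]
    simp only [MeasurableEquiv.piFinSuccAbove_symm_apply, Fin.insertNthEquiv_apply,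
      Fin.insertNth_zero', key]
    rw [lintegral_prod_symm' _ (by fun_prop), Fin.prod_univ_succ]
    have : ∀ v : Fin m → E, ∫⁻ x, h 0 (x + ∑ i, v i) * ∏ j : Fin m, h j.succ (∑ i ∈ Finset.Ici j, v i)
        = (∫⁻ x, h 0 x) * ∏ j : Fin m, h j.succ (∑ i ∈ Finset.Ici j, v i) := by
      intro v
      rw [lintegral_mul_const _ (by fun_prop), lintegral_add_right_eq_self (h 0)]
    simp only [this]
    rw [lintegral_const_mul _ (by fun_prop),
      lintegral_prod_tail_sum m (fun j => h j.succ) (fun j => hh _)]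

theorem lintegral_prod_increments (h : ℝ → ENNReal) (hh : Measurable h) :
    ∀ (m : ℕ) (a : ℝ),
      ∫⁻ r : Fin m → ℝ, ∏ j : Fin m, h ((Fin.cons a r : Fin (m + 1) → ℝ) j.succ -
        (Fin.cons a r : Fin (m + 1) → ℝ) j.castSucc) = (∫⁻ x, h x) ^ m
  | 0, a => by simp [volume_pi]
  | m + 1, a => by
    have key : ∀ (x : ℝ) (v : Fin m → ℝ),
        ∏ j : Fin (m + 1), h ((Fin.cons a (Fin.cons x v : Fin (m + 1) → ℝ) : Fin (m + 2) → ℝ) j.succ -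
          (Fin.cons a (Fin.cons x v : Fin (m + 1) → ℝ) : Fin (m + 2) → ℝ) j.castSucc) =
        h (x - a) * ∏ j : Fin m, h ((Fin.cons x v : Fin (m + 1) → ℝ) j.succ -
          (Fin.cons x v : Fin (m + 1) → ℝ) j.castSucc) := by
      intro x v
      rw [Fin.prod_univ_succ]
      simp
    have hm : ∀ {k : ℕ} (i : Fin (k + 1)), Measurable
        (fun p : ℝ × (Fin k → ℝ) => (Fin.cons p.1 p.2 : Fin (k + 1) → ℝ) i) := by
      intro k i
      refine Fin.cases ?_ (fun j => ?_) i
      · simpa using measurable_fst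
      · simp only [Fin.cons_succ]; fun_prop
    have hm' : ∀ {k : ℕ} (b : ℝ) (i : Fin (k + 1)), Measurable
        (fun p : (Fin k → ℝ) => (Fin.cons b p : Fin (k + 1) → ℝ) i) := by
      intro k b i
      exact (hm i).comp (by fun_prop : Measurable fun p : Fin k → ℝ => (b, p))
    rw [← (volume_preserving_piFinSuccAbove (fun _ : Fin (m + 1) => ℝ) 0).symm.lintegral_comp
      (by fun_prop), Measure.volume_eq_prod]
    have e : ∀ p : ℝ × (Fin m → ℝ), (MeasurableEquiv.piFinSuccAbove (fun _ => ℝ) 0).symm p =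
        (Fin.cons p.1 p.2 : Fin (m + 1) → ℝ) := fun p => Fin.insertNth_zero' p.1 p.2
    simp only [e, key]
    rw [lintegral_prod _ (Measurable.aemeasurable (by fun_prop))]
    have : ∀ x : ℝ, ∫⁻ v : Fin m → ℝ, h (x - a) * ∏ j : Fin m,
        h ((Fin.cons x v : Fin (m + 1) → ℝ) j.succ - (Fin.cons x v : Fin (m + 1) → ℝ) j.castSucc)
        = h (x - a) * (∫⁻ x, h x) ^ m := by
      intro x
      rw [lintegral_const_mul _ (by fun_prop), lintegral_prod_increments h hh m x]
    simp only [this]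
    rw [lintegral_mul_const _ (by fun_prop), lintegral_sub_right_eq_self h, pow_succ']

theorem lintegral_le_factorial_mul {m : ℕ} (H : (Fin m → ℝ) → ENNReal) (hH : Measurable H)
    (hsymm : ∀ (σ : Equiv.Perm (Fin m)) r, H (r ∘ σ) = H r) :
    ∫⁻ r, H r ≤ m.factorial * ∫⁻ r in {r | StrictMono r}, H r := by
  have hS : MeasurableSet {r : Fin m → ℝ | StrictMono r} := by
    have : {r : Fin m → ℝ | StrictMono r} = ⋂ i, ⋂ j, ⋂ _ : i < j, {r | r i < r j} := by
      ext r; simp [StrictMono]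
    rw [this]
    refine .iInter fun i => .iInter fun j => .iInter fun _ => ?_
    exact measurableSet_lt (by fun_prop) (by fun_prop)
  have hinj : ∀ᵐ r : Fin m → ℝ, Function.Injective r := by
    have : ∀ i j : Fin m, i ≠ j → ∀ᵐ r : Fin m → ℝ, r i ≠ r j := by
      intro i j hij
      let W : Submodule ℝ (Fin m → ℝ) :=
        LinearMap.ker (LinearMap.proj (R := ℝ) (φ := fun _ : Fin m => ℝ) i - LinearMap.proj j)
      have hW : W ≠ ⊤ := by
        intro h
        have : (Pi.single i 1 : Fin m → ℝ) ∈ W := h ▸ Submodule.mem_top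
        simp [W, hij.symm] at this
      have := Measure.addHaar_submodule (volume : Measure (Fin m → ℝ)) W hW
      rw [ae_iff]
      convert! this using 2
      ext r; simp [W, sub_eq_zero]
    have h2 : ∀ᵐ r : Fin m → ℝ, ∀ i j, i ≠ j → r i ≠ r j := by
      rw [ae_all_iff]; intro i
      rw [ae_all_iff]; intro j
      by_cases hij : i = j
      · simp [hij]
      · filter_upwards [this i j hij] with r hr _ using hr
    filter_upwards [h2] with r hr i j hij
    by_contra h
    exact hr i j h hij
  calc ∫⁻ r, H r ≤ ∫⁻ r, ∑ σ : Equiv.Perm (Fin m),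
        ({r : Fin m → ℝ | StrictMono r}.indicator H) (r ∘ σ) := by
        refine lintegral_mono_ae ?_
        filter_upwards [hinj] with r hr
        have hmono : StrictMono (r ∘ Tuple.sort r) :=
          (Tuple.monotone_sort r).strictMono_of_injective (hr.comp (Tuple.sort r).injective)
        calc H r = ({r : Fin m → ℝ | StrictMono r}.indicator H) (r ∘ Tuple.sort r) := by
              rw [indicator_of_mem (by exact hmono), hsymm]
          _ ≤ _ := Finset.single_le_sum
              (f := fun σ : Equiv.Perm (Fin m) => ({r : Fin m → ℝ | StrictMono r}.indicator H) (r ∘ σ))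
              (fun _ _ => zero_le) (Finset.mem_univ _)
    _ = ∑ σ : Equiv.Perm (Fin m), ∫⁻ r, ({r : Fin m → ℝ | StrictMono r}.indicator H) (r ∘ σ) := by
        refine lintegral_finsetSum _ fun σ _ => ?_
        exact (hH.indicator hS).comp (by unfold Function.comp; fun_prop)
    _ = ∑ σ : Equiv.Perm (Fin m), ∫⁻ r, ({r : Fin m → ℝ | StrictMono r}.indicator H) r := by
        refine Finset.sum_congr rfl fun σ _ => ?_
        have := volume_measurePreserving_piCongrLeft (fun _ : Fin m => ℝ) σ⁻¹
        rw [← this.lintegral_comp (hH.indicator hS)]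
        refine lintegral_congr fun r => ?_
        congr 1
        ext i
        simp [MeasurableEquiv.coe_piCongrLeft, Equiv.piCongrLeft_apply]
        rfl
    _ = _ := by
        rw [Finset.sum_const, Finset.card_univ, Fintype.card_perm, Fintype.card_fin,
          lintegral_indicator hS, nsmul_eq_mul]

/-- Decay profile of the characteristic function in one frequency coordinate, at scale `a`. -/
def decayProfile (a x : ℝ) : ENNReal :=
  if x = 0 then ⊤ else ENNReal.ofReal (min 1 ((|x| ^ 4)⁻¹ * (a ^ 4)⁻¹))

theorem measurable_decayProfile (a : ℝ) : Measurable (decayProfile a) :=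
  Measurable.ite (measurableSet_singleton 0) measurable_const (by fun_prop)

theorem weight_mul_decay_le {e A a x : ℝ} (he0 : 0 ≤ e) (he2 : e ≤ 2) (hA : 1 ≤ A) (ha : 0 < a)
    (haA : a ≤ A) (hx : x ≠ 0) :
    (1 + |x|) ^ e * min 1 ((|x| ^ 4)⁻¹ * (a ^ 4)⁻¹) ≤
      16 * A ^ e * a ^ (-e) * (1 + ‖a * x‖) ^ (-2 : ℝ) := by
  set y := a * |x| with hy
  have hx' : 0 < |x| := abs_pos.2 hx
  have hy0 : 0 < y := by positivity
  have hn : ‖a * x‖ = y := by rw [norm_mul, Real.norm_eq_abs, Real.norm_eq_abs, abs_of_pos ha]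
  have h1 : (1 + |x|) ^ e ≤ A ^ e * a ^ (-e) * (1 + y) ^ (2 : ℝ) := by
    have : 1 + |x| ≤ A * a⁻¹ * (1 + y) := by
      rw [hy, mul_assoc, mul_add, mul_one, inv_mul_cancel_left₀ ha.ne', mul_add]
      have : 1 ≤ A * a⁻¹ := by rw [← div_eq_mul_inv, le_div_iff₀ ha]; linarith
      nlinarith
    calc (1 + |x|) ^ e ≤ (A * a⁻¹ * (1 + y)) ^ e := by gcongr
      _ = A ^ e * a ^ (-e) * (1 + y) ^ e := by
        rw [Real.mul_rpow (by positivity) (by positivity), Real.mul_rpow (by positivity)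
          (by positivity), Real.inv_rpow ha.le, Real.rpow_neg ha.le]
      _ ≤ _ := by
        gcongr
        linarith
  have h2 : min 1 ((|x| ^ 4)⁻¹ * (a ^ 4)⁻¹) ≤ 16 * ((1 + y) ^ 4)⁻¹ := by
    rw [← mul_inv, ← mul_pow, mul_comm |x|, ← hy]
    rcases le_total y 1 with h | h
    · refine (min_le_left _ _).trans ?_
      rw [← div_eq_mul_inv, le_div_iff₀ (by positivity), one_mul]
      calc (1 + y) ^ 4 ≤ (2 : ℝ) ^ 4 := by gcongr; linarith
        _ = 16 := by norm_num
    · refine (min_le_right _ _).trans ?_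
      rw [← div_eq_mul_inv, le_div_iff₀ (by positivity), inv_mul_le_iff₀ (by positivity)]
      calc (1 + y) ^ 4 ≤ (2 * y) ^ 4 := by gcongr; linarith
        _ = y ^ 4 * 16 := by ring
  rw [hn]
  calc _ ≤ (A ^ e * a ^ (-e) * (1 + y) ^ (2 : ℝ)) * (16 * ((1 + y) ^ 4)⁻¹) := by gcongr
    _ = 16 * A ^ e * a ^ (-e) * ((1 + y) ^ (2 : ℝ) * ((1 + y) ^ 4)⁻¹) := by ring
    _ = _ := by
      congr 1
      rw [Real.rpow_neg (by positivity)]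
      norm_cast
      field_simp

theorem lintegral_weight_mul_decayProfile {e A : ℝ} (he0 : 0 ≤ e) (he2 : e ≤ 2) (hA : 1 ≤ A) :
    ∃ C : ℝ, 0 < C ∧ ∀ a, 0 < a → a ≤ A →
      ∫⁻ x : ℝ, ENNReal.ofReal ((1 + |x|) ^ e) * decayProfile a x ≤
        ENNReal.ofReal (C * a ^ (-(1 + e))) := by
  set J := ∫ x : ℝ, (1 + ‖x‖) ^ (-2 : ℝ) with hJ
  have hJ0 : 0 ≤ J := integral_nonneg fun x => by positivity
  have hint : Integrable fun x : ℝ => (1 + ‖x‖) ^ (-2 : ℝ) :=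
    integrable_one_add_norm (by simp)
  refine ⟨16 * A ^ e * J + 1, by positivity, fun a ha haA => ?_⟩
  have hint' : Integrable fun x : ℝ => 16 * A ^ e * a ^ (-e) * (1 + ‖a * x‖) ^ (-2 : ℝ) :=
    (hint.comp_mul_left' ha.ne').const_mul _
  calc ∫⁻ x : ℝ, ENNReal.ofReal ((1 + |x|) ^ e) * decayProfile a x
      ≤ ∫⁻ x : ℝ, ENNReal.ofReal (16 * A ^ e * a ^ (-e) * (1 + ‖a * x‖) ^ (-2 : ℝ)) := by
        refine lintegral_mono_ae ?_
        filter_upwards [Measure.ae_ne volume (0 : ℝ)] with x hx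
        rw [decayProfile, if_neg hx, ← ENNReal.ofReal_mul (by positivity)]
        exact ENNReal.ofReal_le_ofReal (weight_mul_decay_le he0 he2 hA ha haA hx)
    _ = ENNReal.ofReal (∫ x : ℝ, 16 * A ^ e * a ^ (-e) * (1 + ‖a * x‖) ^ (-2 : ℝ)) :=
        (ofReal_integral_eq_lintegral_ofReal hint' (ae_of_all _ fun x => by positivity)).symm
    _ ≤ _ := by
        apply ENNReal.ofReal_le_ofReal
        rw [integral_const_mul, Measure.integral_comp_mul_left (fun x : ℝ => (1 + ‖x‖) ^ (-2 : ℝ)),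
          abs_of_pos (inv_pos.2 ha), smul_eq_mul, ← hJ]
        have : a ^ (-(1 + e)) = a⁻¹ * a ^ (-e) := by
          rw [neg_add, Real.rpow_add ha, Real.rpow_neg_one]
        rw [this]
        have h3 : 0 ≤ a⁻¹ * a ^ (-e) := by positivity
        nlinarith

theorem lintegral_prod_coord (h : ℝ → ENNReal) (hh : Measurable h) :
    ∀ m : ℕ, ∫⁻ r : Fin m → ℝ, ∏ j : Fin m, h (r j) = (∫⁻ x, h x) ^ m
  | 0 => by simp [volume_pi]
  | m + 1 => by
    rw [← (volume_preserving_piFinSuccAbove (fun _ : Fin (m + 1) => ℝ) 0).symm.lintegral_comp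
      (by fun_prop), Measure.volume_eq_prod]
    have e : ∀ p : ℝ × (Fin m → ℝ), (MeasurableEquiv.piFinSuccAbove (fun _ => ℝ) 0).symm p =
        (Fin.cons p.1 p.2 : Fin (m + 1) → ℝ) := fun p => Fin.insertNth_zero' p.1 p.2
    simp only [e, Fin.prod_univ_succ, Fin.cons_zero, Fin.cons_succ]
    rw [lintegral_prod_mul (f := h) (g := fun r : Fin m → ℝ => ∏ j, h (r j)) (by fun_prop)
      (Measurable.aemeasurable (by fun_prop)), lintegral_prod_coord h hh m, pow_succ']

theorem lintegral_euclidean_prod_coord {d : ℕ} (h : ℝ → ENNReal) (hh : Measurable h) :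
    ∫⁻ u : Ed d, ∏ l, h (u l) = (∫⁻ x, h x) ^ d := by
  rw [← lintegral_prod_coord h hh d,
    ← (PiLp.volume_preserving_toLp (Fin d)).lintegral_comp (by fun_prop)]

/-- Consecutive gaps of `0, r 0, r 1, …`. -/
def gap {m : ℕ} (r : Fin m → ℝ) (j : Fin m) : ℝ :=
  (Fin.cons 0 r : Fin (m + 1) → ℝ) j.succ - (Fin.cons 0 r : Fin (m + 1) → ℝ) j.castSucc

theorem strictMono_cons {m : ℕ} {r : Fin m → ℝ} (hr : StrictMono r) (h0 : ∀ j, 0 < r j) :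
    StrictMono (Fin.cons 0 r : Fin (m + 1) → ℝ) := by
  intro i j hij
  induction i using Fin.cases with
  | zero =>
    induction j using Fin.cases with
    | zero => exact absurd hij (lt_irrefl _)
    | succ j => simpa using h0 j
  | succ i =>
    induction j using Fin.cases with
    | zero => exact absurd hij (by simp)
    | succ j => simpa using hr (by simpa using hij)

theorem gap_pos {m : ℕ} {r : Fin m → ℝ} (hr : StrictMono r) (h0 : ∀ j, 0 < r j) (j : Fin m) :
    0 < gap r j :=
  sub_pos.2 (strictMono_cons hr h0 Fin.castSucc_lt_succ)

theorem gap_le {m : ℕ} {r : Fin m → ℝ} {T : ℝ} (h0 : ∀ j, 0 < r j)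
    (hT : ∀ j, r j < T) (j : Fin m) : gap r j ≤ T := by
  have h1 : (0 : ℝ) ≤ (Fin.cons 0 r : Fin (m + 1) → ℝ) j.castSucc := by
    induction j.castSucc using Fin.cases with
    | zero => simp
    | succ i => simpa using (h0 i).le
  have := hT j
  simp only [gap, Fin.cons_succ]
  linarith

theorem sum_inner_eq_sum_inner_tail {V : Type*} [NormedAddCommGroup V] [InnerProductSpace ℝ V] :
    ∀ {m : ℕ} (Z : Fin (m + 1) → V) (u : Fin m → V),
      ∑ j, ⟪u j, Z j.succ - Z 0⟫ = ∑ j, ⟪∑ i ∈ Finset.Ici j, u i, Z j.succ - Z j.castSucc⟫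
  | 0, Z, u => by simp
  | m + 1, Z, u => by
    have ih := sum_inner_eq_sum_inner_tail (fun i => Z i.succ) (fun i => u i.succ)
    rw [Fin.sum_univ_succ, Fin.sum_univ_succ (f := fun j => ⟪∑ i ∈ Finset.Ici j, u i, _⟫)]
    have h0 : ∑ i ∈ Finset.Ici (0 : Fin (m + 1)), u i = u 0 + ∑ i : Fin m, u i.succ := by
      rw [show Finset.Ici (0 : Fin (m + 1)) = Finset.univ by ext; simp, Fin.sum_univ_succ]
    have h1 : ∀ j : Fin m, ∑ i ∈ Finset.Ici j.succ, u i = ∑ i ∈ Finset.Ici j, u i.succ := by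
      intro j
      have : Finset.Ici j.succ = (Finset.Ici j).map (Fin.succEmb m) := by simp
      rw [this, Finset.sum_map]
      simp
    simp only [h0, h1]
    simp only [Fin.succ_castSucc] at ih ⊢
    rw [← ih, inner_add_left, sum_inner, add_assoc (inner ℝ (u 0) _), ← Finset.sum_add_distrib]
    simp only [← inner_add_right, Fin.castSucc_zero]
    simp

theorem prod_eq_top_of_ne_zero {ι : Type*} {s : Finset ι} {f : ι → ENNReal}
    (h0 : ∀ i ∈ s, f i ≠ 0) {i : ι} (hi : i ∈ s) (htop : f i = ⊤) : ∏ i ∈ s, f i = ⊤ := by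
  classical
  rw [← Finset.mul_prod_erase s f hi, htop, ENNReal.top_mul]
  exact Finset.prod_ne_zero_iff.2 fun j hj => h0 j (Finset.mem_of_mem_erase hj)

theorem decayProfile_ne_zero {a : ℝ} (ha : 0 < a) (x : ℝ) : decayProfile a x ≠ 0 := by
  unfold decayProfile
  split_ifs with h
  · simp
  · have : 0 < |x| := abs_pos.2 h
    simp only [ne_eq, ENNReal.ofReal_eq_zero, not_le, lt_min_iff]
    constructor <;> positivity

theorem CondA1.charFun_bound {Ω : Type*} [MeasurableSpace Ω] {d : ℕ} {P : Measure Ω}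
    {X : ℝ → Ω → Ed d} {T α θ : ℝ} (hA : CondA1 P X T α θ) {m : ℕ} (hm : 0 < m) :
    ∃ K : ℝ, 0 < K ∧ ∀ r : Fin m → ℝ, StrictMono r → (∀ j, 0 < r j) → (∀ j, r j < T) →
      ∀ u : Fin m → Ed d,
        ‖∫ ω, Complex.exp (Complex.I * Complex.ofReal
          (∑ j, 2 * Real.pi * ⟪u j, X (r j) ω - X 0 ω⟫)) ∂P‖ₑ ≤
        ENNReal.ofReal K * ∏ j, ∏ l, decayProfile (gap r j ^ α) ((∑ i ∈ Finset.Ici j, u i) l) := by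
  obtain ⟨C, hC, hA⟩ := hA
  refine ⟨C ^ m * (m : ℝ) ^ (α * θ * (m : ℝ)), by positivity, fun r hr h0 hT u => ?_⟩
  have hg := gap_pos hr h0
  set s : Fin m → Ed d := fun j => ∑ i ∈ Finset.Ici j, u i with hs
  by_cases hz : ∃ j l, s j l = 0
  · obtain ⟨j, l, hjl⟩ := hz
    have hpos : ∀ j l, decayProfile (gap r j ^ α) (s j l) ≠ 0 := fun j l =>
      decayProfile_ne_zero (Real.rpow_pos_of_pos (hg j) _) _
    have : ∏ j, ∏ l, decayProfile (gap r j ^ α) (s j l) = ⊤ := by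
      refine prod_eq_top_of_ne_zero (fun i _ => Finset.prod_ne_zero_iff.2 fun l _ => hpos i l)
        (Finset.mem_univ j) ?_
      exact prod_eq_top_of_ne_zero (fun l _ => hpos j l) (Finset.mem_univ l)
        (by simp [decayProfile, hjl])
    rw [this, ENNReal.mul_top]
    · exact le_top
    · simp only [ne_eq, ENNReal.ofReal_eq_zero, not_le]; positivity
  · push Not at hz
    let k : Fin m → Fin d → ℕ := fun j l =>
      if (|s j l| ^ 4)⁻¹ * ((gap r j ^ α) ^ 4)⁻¹ ≤ 1 then 4 else 0
    have hb := hA m hm (fun j => (2 * Real.pi) • s j)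
      (fun j l => by
        simp only [PiLp.smul_apply, smul_eq_mul]
        exact mul_ne_zero (by positivity) (hz j l))
      (Fin.cons 0 r) (strictMono_cons hr h0) (by simp)
      (by obtain ⟨n, rfl⟩ := Nat.exists_eq_succ_of_ne_zero hm.ne'
          rw [← Fin.succ_last, Fin.cons_succ]; exact hT _)
      k (fun j l => by simp only [k]; split_ifs <;> simp)
    have hphase : ∀ ω, ∑ j, 2 * Real.pi * ⟪u j, X (r j) ω - X 0 ω⟫ =
        ∑ j : Fin m, ⟪(2 * Real.pi) • s j, X ((Fin.cons 0 r : Fin (m + 1) → ℝ) j.succ) ω -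
          X ((Fin.cons 0 r : Fin (m + 1) → ℝ) j.castSucc) ω⟫ := by
      intro ω
      have := sum_inner_eq_sum_inner_tail
        (fun i => X ((Fin.cons 0 r : Fin (m + 1) → ℝ) i) ω) u
      simp only [Fin.cons_succ, Fin.cons_zero] at this
      simp only [inner_smul_left, ← Finset.mul_sum, Fin.cons_succ, hs]
      rw [this]
      simp
    simp only [hphase]
    rw [← ofReal_norm]
    refine (ENNReal.ofReal_le_ofReal hb).trans ?_
    rw [ENNReal.ofReal_mul (by positivity)]
    gcongr
    rw [ENNReal.ofReal_prod_of_nonneg]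
    swap
    · intro j _
      have := hg j
      simp only [gap] at this
      positivity
    gcongr with j _
    rw [ENNReal.ofReal_prod_of_nonneg]
    swap
    · intro l _
      have := hg j
      simp only [gap] at this
      positivity
    gcongr with l _
    rw [decayProfile, if_neg (hz j l)]
    apply ENNReal.ofReal_le_ofReal
    change (|((2 * Real.pi) • s j) l| ^ k j l)⁻¹ * (gap r j ^ (α * (k j l : ℝ)))⁻¹ ≤
      min 1 ((|s j l| ^ 4)⁻¹ * ((gap r j ^ α) ^ 4)⁻¹)
    rw [Real.rpow_mul_natCast (hg j).le]
    have hsp : 0 < |s j l| := abs_pos.2 (hz j l)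
    have hgp : 0 < gap r j ^ α := Real.rpow_pos_of_pos (hg j) _
    by_cases hk : (|s j l| ^ 4)⁻¹ * ((gap r j ^ α) ^ 4)⁻¹ ≤ 1
    · have hle : |s j l| ≤ |((2 * Real.pi) • s j) l| := by
        rw [PiLp.smul_apply, smul_eq_mul, abs_mul, abs_of_pos Real.two_pi_pos]
        have := Real.pi_gt_three
        nlinarith
      simp only [k, if_pos hk, min_eq_right hk]
      generalize |((2 * Real.pi) • s j) l| = b at hle ⊢
      gcongr
    · simp only [k, if_neg hk, min_eq_left (not_le.1 hk).le]
      simp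

theorem prod_mul_le_prod_tail_sq {E : Type*} [AddCommGroup E] (w : E → ENNReal) (h0 : w 0 ≤ 1)
    (hsub : ∀ x y, w (x - y) ≤ w x * w y) :
    ∀ {m : ℕ} (u : Fin m → E),
      (∏ j, w (u j)) * w (∑ j, u j) ≤ ∏ j, w (∑ i ∈ Finset.Ici j, u i) ^ 2
  | 0, u => by simpa using h0
  | m + 1, u => by
    have ih := prod_mul_le_prod_tail_sq w h0 hsub (fun i => u i.succ)
    have e0 : ∑ i ∈ Finset.Ici (0 : Fin (m + 1)), u i = u 0 + ∑ i : Fin m, u i.succ := by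
      rw [show Finset.Ici (0 : Fin (m + 1)) = Finset.univ by ext; simp, Fin.sum_univ_succ]
    have e1 : ∀ j : Fin m, ∑ i ∈ Finset.Ici j.succ, u i = ∑ i ∈ Finset.Ici j, u i.succ := by
      intro j
      have : Finset.Ici j.succ = (Finset.Ici j).map (Fin.succEmb m) := by simp
      rw [this, Finset.sum_map]
      simp
    rw [Fin.prod_univ_succ, Fin.prod_univ_succ, Fin.sum_univ_succ, e0]
    simp only [e1]
    set S := ∑ i : Fin m, u i.succ
    have h1 : w (u 0) ≤ w (u 0 + S) * w S := by simpa using hsub (u 0 + S) S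
    calc w (u 0) * (∏ i : Fin m, w (u i.succ)) * w (u 0 + S)
        ≤ (w (u 0 + S) * w S) * (∏ i : Fin m, w (u i.succ)) * w (u 0 + S) := by gcongr
      _ = w (u 0 + S) ^ 2 * ((∏ i : Fin m, w (u i.succ)) * w S) := by ring
      _ ≤ _ := by gcongr

theorem prod_le_prod_tail_sq {E : Type*} [AddCommGroup E] (w : E → ENNReal) (h0 : w 0 ≤ 1)
    (hsub : ∀ x y, w (x - y) ≤ w x * w y) (h1 : ∀ x, 1 ≤ w x) {m : ℕ} (u : Fin m → E) :
    ∏ j, w (u j) ≤ ∏ j, w (∑ i ∈ Finset.Ici j, u i) ^ 2 :=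
  (le_mul_of_one_le_right' (h1 _)).trans (prod_mul_le_prod_tail_sq w h0 hsub u)

/-- Polynomial weight on frequencies. -/
def freqWeight {d : ℕ} (γ : ℝ) (u : Ed d) : ENNReal := ∏ l, ENNReal.ofReal ((1 + |u l|) ^ γ)

theorem one_le_freqWeight {d : ℕ} {γ : ℝ} (hγ : 0 ≤ γ) (u : Ed d) : 1 ≤ freqWeight γ u := by
  refine Finset.one_le_prod' fun l _ => ?_
  rw [ENNReal.one_le_ofReal]
  exact Real.one_le_rpow (by linarith [abs_nonneg (u l)]) hγ

theorem freqWeight_sub_le {d : ℕ} {γ : ℝ} (hγ : 0 ≤ γ) (u v : Ed d) :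
    freqWeight γ (u - v) ≤ freqWeight γ u * freqWeight γ v := by
  unfold freqWeight
  rw [← Finset.prod_mul_distrib]
  gcongr with l _
  rw [← ENNReal.ofReal_mul (by positivity), ← Real.mul_rpow (by positivity) (by positivity)]
  gcongr
  have := abs_sub (u l) (v l)
  simp only [PiLp.sub_apply]
  nlinarith [abs_nonneg (u l), abs_nonneg (v l)]

theorem freqWeight_sq {d : ℕ} {γ : ℝ} (u : Ed d) : freqWeight γ u ^ 2 = freqWeight (2 * γ) u := by
  unfold freqWeight
  rw [← Finset.prod_pow]
  refine Finset.prod_congr rfl fun l _ => ?_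
  rw [← ENNReal.ofReal_pow (by positivity), mul_comm 2 γ]
  congr 1
  exact_mod_cast (Real.rpow_mul_natCast (by positivity) γ 2).symm

theorem lintegral_freqWeight_mul_charFun {m d : ℕ} {γ α T : ℝ} (hα : 0 < α)
    (hγ0 : 0 ≤ γ) (hγ1 : γ ≤ 1) :
    ∃ C : ℝ, 0 < C ∧ ∀ (K : ENNReal) (r : Fin m → ℝ), StrictMono r → (∀ j, 0 < r j) →
      (∀ j, r j < T) → ∀ χ : (Fin m → Ed d) → ENNReal,
      (∀ u, χ u ≤ K * ∏ j, ∏ l, decayProfile (gap r j ^ α) ((∑ i ∈ Finset.Ici j, u i) l)) →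
      ∫⁻ u, (∏ j, freqWeight γ (u j)) * χ u ≤
        K * ∏ j, ENNReal.ofReal (C * gap r j ^ (-(α * (1 + 2 * γ)))) ^ d := by
  obtain ⟨C, hC, hCb⟩ := lintegral_weight_mul_decayProfile (e := 2 * γ) (A := max 1 (T ^ α))
    (by linarith) (by linarith) (le_max_left _ _)
  refine ⟨C, hC, fun K r hr h0 hrT χ hχ => ?_⟩
  have hg := gap_pos hr h0
  have hmeas : ∀ a : ℝ, Measurable fun x : ℝ => ENNReal.ofReal ((1 + |x|) ^ (2 * γ)) *
      decayProfile a x := fun a => by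
    have := measurable_decayProfile a
    fun_prop
  let h : Fin m → Ed d → ENNReal := fun j x =>
    ∏ l, (ENNReal.ofReal ((1 + |x l|) ^ (2 * γ)) * decayProfile (gap r j ^ α) (x l))
  have hhm : ∀ j, Measurable (h j) := fun j =>
    Finset.measurable_prod _ fun l _ => (hmeas _).comp (by fun_prop)
  calc ∫⁻ u, (∏ j, freqWeight γ (u j)) * χ u
      ≤ ∫⁻ u : Fin m → Ed d, K * ∏ j, h j (∑ i ∈ Finset.Ici j, u i) := by
        refine lintegral_mono fun u => ?_
        calc (∏ j, freqWeight γ (u j)) * χ u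
            ≤ (∏ j, freqWeight γ (∑ i ∈ Finset.Ici j, u i) ^ 2) *
              (K * ∏ j, ∏ l, decayProfile (gap r j ^ α) ((∑ i ∈ Finset.Ici j, u i) l)) := by
              refine mul_le_mul' ?_ (hχ u)
              exact prod_le_prod_tail_sq _ (by simp [freqWeight]) (freqWeight_sub_le hγ0)
                (one_le_freqWeight hγ0) u
          _ = _ := by
              simp only [freqWeight_sq]
              simp only [h, Finset.prod_mul_distrib, freqWeight]
              ring
    _ = K * ∏ j, ∫⁻ x, h j x := by
        rw [lintegral_const_mul, lintegral_prod_tail_sum m h hhm]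
        exact Finset.measurable_prod _ fun j _ => (hhm j).comp
          (Finset.measurable_sum _ fun i _ => measurable_pi_apply i)
    _ ≤ _ := by
        gcongr with j _
        rw [lintegral_euclidean_prod_coord _ (hmeas _)]
        gcongr
        refine (hCb _ (Real.rpow_pos_of_pos (hg j) _) (le_max_of_le_right ?_)).trans_eq ?_
        · exact Real.rpow_le_rpow (hg j).le (gap_le h0 hrT j) hα.le
        · rw [← Real.rpow_mul (hg j).le, mul_neg]

theorem lintegral_simplex_gap_lt_top {m d : ℕ} {T β : ℝ} (C : ℝ) (hC : 0 < C) (hβ : β * d < 1) :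
    ∫⁻ r : Fin m → ℝ in {r | StrictMono r}, {r : Fin m → ℝ | ∀ j, r j ∈ Ioo 0 T}.indicator
      (fun r => ∏ j, ENNReal.ofReal (C * gap r j ^ (-β)) ^ d) r < ⊤ := by
  let h : ℝ → ENNReal := (Ioc 0 T).indicator fun x => ENNReal.ofReal (C * x ^ (-β)) ^ d
  have hh : Measurable h := Measurable.indicator (by fun_prop) measurableSet_Ioc
  have hfin : ∫⁻ x, h x < ⊤ := by
    rw [lintegral_indicator measurableSet_Ioc]
    rcases le_or_gt T 0 with hT | hT
    · simp [Ioc_eq_empty_of_le hT]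
    have hi : IntervalIntegrable (fun x : ℝ => x ^ (-(β * d))) volume 0 T :=
      intervalIntegral.intervalIntegrable_rpow' (by linarith)
    rw [intervalIntegrable_iff_integrableOn_Ioc_of_le hT.le] at hi
    have hi2 := (hi.const_mul (C ^ d)).lintegral_lt_top
    refine lt_of_le_of_lt (le_of_eq ?_) hi2
    refine setLIntegral_congr_fun measurableSet_Ioc fun x hx => ?_
    rw [← ENNReal.ofReal_pow (by have := hx.1; positivity), mul_pow, ← Real.rpow_mul_natCast hx.1.le,
      neg_mul]
  calc _ ≤ ∫⁻ r : Fin m → ℝ in {r | StrictMono r}, ∏ j, h (gap r j) := by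
        refine setLIntegral_mono' ?_ fun r hr => ?_
        · have : {r : Fin m → ℝ | StrictMono r} = ⋂ i, ⋂ j, ⋂ _ : i < j, {r | r i < r j} := by
            ext r; simp [StrictMono]
          rw [this]
          refine .iInter fun i => .iInter fun j => .iInter fun _ => ?_
          exact measurableSet_lt (by fun_prop) (by fun_prop)
        · refine indicator_apply_le' (fun hrT => ?_) (fun _ => zero_le)
          gcongr with j _
          have : gap r j ∈ Ioc 0 T := ⟨gap_pos hr (fun j => (hrT j).1) j,
            gap_le (fun j => (hrT j).1) (fun j => (hrT j).2) j⟩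
          simp only [h, indicator_of_mem this]
          exact le_rfl
    _ ≤ ∫⁻ r : Fin m → ℝ, ∏ j, h (gap r j) := setLIntegral_le_lintegral _ _
    _ = (∫⁻ x, h x) ^ m := lintegral_prod_increments h hh m 0
    _ < ⊤ := ENNReal.pow_lt_top hfin

theorem enorm_integral_prod_le {Ω : Type*} [MeasurableSpace Ω] {P : Measure Ω}
    [IsProbabilityMeasure P] {d m : ℕ} {f : Ed d → ℝ} {g : Ed d → ℂ} (hg : Integrable g)
    (hfg : ∀ y, (f y : ℂ) = ∫ w, Complex.exp (Complex.I * Complex.ofReal (2 * Real.pi * ⟪w, y⟫)) * g w)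
    {Z : Fin m → Ω → Ed d} (hZ : ∀ j, Measurable (Z j)) :
    ‖∫ ω, ∏ j, f (Z j ω) ∂P‖ₑ ≤ ∫⁻ u : Fin m → Ed d, (∏ j, ‖g (u j)‖ₑ) *
      ‖∫ ω, Complex.exp (Complex.I * Complex.ofReal
        (∑ j, 2 * Real.pi * ⟪u j, Z j ω⟫)) ∂P‖ₑ := by
  have hexp : ∀ (ω : Ω) (u : Fin m → Ed d),
      ∏ j, (Complex.exp (Complex.I * Complex.ofReal (2 * Real.pi * ⟪u j, Z j ω⟫)) * g (u j)) =
      Complex.exp (Complex.I * Complex.ofReal (∑ j, 2 * Real.pi * ⟪u j, Z j ω⟫)) *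
        ∏ j, g (u j) := by
    intro ω u
    rw [Finset.prod_mul_distrib, ← Complex.exp_sum, Complex.ofReal_sum, Finset.mul_sum]
  have hint : Integrable (fun p : Ω × (Fin m → Ed d) =>
      Complex.exp (Complex.I * Complex.ofReal (∑ j, 2 * Real.pi * ⟪p.2 j, Z j p.1⟫)) *
        ∏ j, g (p.2 j)) (P.prod volume) := by
    have h1 : Integrable (fun u : Fin m → Ed d => ∏ j, g (u j)) :=
      Integrable.fintype_prod (f := fun _ => g) fun _ => hg
    have h2 : Integrable (fun p : Ω × (Fin m → Ed d) => ∏ j, g (p.2 j)) (P.prod volume) :=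
      h1.comp_snd P
    refine h2.bdd_mul (c := 1) ?_ (ae_of_all _ fun p => ?_)
    · refine Measurable.aestronglyMeasurable ?_
      have : ∀ j, Measurable fun p : Ω × (Fin m → Ed d) => Z j p.1 := fun j =>
        (hZ j).comp measurable_fst
      fun_prop
    · rw [mul_comm, Complex.norm_exp_ofReal_mul_I]
  have key : ((∫ ω, ∏ j, f (Z j ω) ∂P : ℝ) : ℂ) = ∫ u : Fin m → Ed d,
      (∏ j, g (u j)) * ∫ ω, Complex.exp (Complex.I * Complex.ofReal
        (∑ j, 2 * Real.pi * ⟪u j, Z j ω⟫)) ∂P := by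
    rw [← integral_complex_ofReal]
    calc ∫ ω, ((∏ j, f (Z j ω) : ℝ) : ℂ) ∂P
        = ∫ ω, (∫ u : Fin m → Ed d,
          Complex.exp (Complex.I * Complex.ofReal (∑ j, 2 * Real.pi * ⟪u j, Z j ω⟫)) *
            ∏ j, g (u j)) ∂P := by
          refine integral_congr_ae (ae_of_all _ fun ω => ?_)
          simp only [← hexp]
          rw [integral_fintype_prod_volume_eq_prod (fun j w =>
            Complex.exp (Complex.I * Complex.ofReal (2 * Real.pi * ⟪w, Z j ω⟫)) * g w)]
          simp only [Complex.ofReal_prod, hfg]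
      _ = ∫ u : Fin m → Ed d, ∫ ω,
          Complex.exp (Complex.I * Complex.ofReal (∑ j, 2 * Real.pi * ⟪u j, Z j ω⟫)) *
            ∏ j, g (u j) ∂P := integral_integral_swap hint
      _ = _ := by
          refine integral_congr_ae (ae_of_all _ fun u => ?_)
          simp only
          rw [integral_mul_const, mul_comm]
  have : ‖∫ ω, ∏ j, f (Z j ω) ∂P‖ₑ = ‖((∫ ω, ∏ j, f (Z j ω) ∂P : ℝ) : ℂ)‖ₑ := by
    simp only [enorm_eq_nnnorm, Complex.nnnorm_real]
  rw [this, key]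
  refine (enorm_integral_le_lintegral_enorm _).trans (lintegral_mono fun u => ?_)
  rw [enorm_mul]
  gcongr
  simp only [enorm_eq_nnnorm, nnnorm_prod]
  push_cast
  exact le_rfl

theorem moment_le_lintegral_simplex {Ω : Type*} [MeasurableSpace Ω] {P : Measure Ω}
    [IsProbabilityMeasure P] {d m : ℕ} (hm : Even m) {Y : ℝ → Ω → Ed d}
    (hY : Measurable (Function.uncurry Y)) {f : Ed d → ℝ} (hf : Measurable f) {M : ℝ}
    (hM : ∀ y, |f y| ≤ M) {t T : ℝ} (htT : t ≤ T) :
    ∫⁻ ω, ENNReal.ofReal ((∫ r in Ioo 0 t, f (Y r ω)) ^ m) ∂P ≤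
      m.factorial * ∫⁻ r : Fin m → ℝ in {r | StrictMono r},
        {r : Fin m → ℝ | ∀ j, r j ∈ Ioo 0 T}.indicator
          (fun r => ‖∫ ω, ∏ j, f (Y (r j) ω) ∂P‖ₑ) r := by
  have hcube : MeasurableSet {r : Fin m → ℝ | ∀ j, r j ∈ Ioo 0 T} := by
    simp only [ofPred_forall]
    exact MeasurableSet.iInter fun j => measurableSet_Ioo.preimage (measurable_pi_apply j)
  have hYr : ∀ j : Fin m, Measurable fun p : Ω × (Fin m → ℝ) => Y (p.2 j) p.1 := fun j =>
    hY.comp (f := fun p : Ω × (Fin m → ℝ) => (p.2 j, p.1)) (by fun_prop)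
  have hprod : Measurable fun p : Ω × (Fin m → ℝ) => ∏ j, f (Y (p.2 j) p.1) :=
    Finset.measurable_prod _ fun j _ => hf.comp (hYr j)
  have hbound : ∀ p : Ω × (Fin m → ℝ), ‖∏ j, f (Y (p.2 j) p.1)‖ ≤ M ^ m := by
    intro p
    rw [norm_prod]
    refine (Finset.prod_le_prod (fun _ _ => norm_nonneg _) (fun j _ => hM _)).trans ?_
    simp
  have hHm : Measurable fun r : Fin m → ℝ => ‖∫ ω, ∏ j, f (Y (r j) ω) ∂P‖ₑ := by
    refine Measurable.enorm ?_
    exact (StronglyMeasurable.integral_prod_right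
      (f := fun (r : Fin m → ℝ) (ω : Ω) => ∏ j, f (Y (r j) ω))
      (hprod.comp measurable_swap).stronglyMeasurable).measurable
  let μ : Measure (Fin m → ℝ) := Measure.pi fun _ => (volume.restrict (Ioo 0 t))
  have hμ : μ = (volume : Measure (Fin m → ℝ)).restrict (univ.pi fun _ => Ioo 0 t) := by
    rw [volume_pi, Measure.restrict_pi_pi]
  have : IsFiniteMeasure μ := by
    have : IsFiniteMeasure (volume.restrict (Ioo 0 t)) := ⟨by simp⟩
    infer_instance
  have hint : Integrable (fun p : Ω × (Fin m → ℝ) => ∏ j, f (Y (p.2 j) p.1)) (P.prod μ) :=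
    Integrable.of_bound hprod.aestronglyMeasurable (M ^ m) (ae_of_all _ hbound)
  have hpow : ∀ ω, (∫ r in Ioo 0 t, f (Y r ω)) ^ m = ∫ r, ∏ j, f (Y (r j) ω) ∂μ := by
    intro ω
    rw [integral_fintype_prod_eq_pow (fun r => f (Y r ω)), Fintype.card_fin]
  calc ∫⁻ ω, ENNReal.ofReal ((∫ r in Ioo 0 t, f (Y r ω)) ^ m) ∂P
      = ∫⁻ ω, ENNReal.ofReal (∫ r, ∏ j, f (Y (r j) ω) ∂μ) ∂P := by simp only [hpow]
    _ = ENNReal.ofReal (∫ ω, ∫ r, ∏ j, f (Y (r j) ω) ∂μ ∂P) := by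
        rw [ofReal_integral_eq_lintegral_ofReal hint.integral_prod_left]
        exact ae_of_all _ fun ω => by
          simp only [← hpow]
          exact hm.pow_nonneg _
    _ = ENNReal.ofReal (∫ r, ∫ ω, ∏ j, f (Y (r j) ω) ∂P ∂μ) := by
        rw [integral_integral_swap hint]
    _ ≤ ‖∫ r, ∫ ω, ∏ j, f (Y (r j) ω) ∂P ∂μ‖ₑ := Real.ofReal_le_enorm _
    _ ≤ ∫⁻ r, ‖∫ ω, ∏ j, f (Y (r j) ω) ∂P‖ₑ ∂μ := enorm_integral_le_lintegral_enorm _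
    _ ≤ ∫⁻ r, {r : Fin m → ℝ | ∀ j, r j ∈ Ioo 0 T}.indicator
          (fun r => ‖∫ ω, ∏ j, f (Y (r j) ω) ∂P‖ₑ) r := by
        rw [hμ, lintegral_indicator hcube]
        refine lintegral_mono_set fun r hr j => ?_
        exact Ioo_subset_Ioo_right htT (hr j (mem_univ j))
    _ ≤ _ := by
        refine lintegral_le_factorial_mul _ (hHm.indicator hcube) fun σ r => ?_
        have e1 : (r ∘ σ ∈ {r : Fin m → ℝ | ∀ j, r j ∈ Ioo 0 T}) ↔
            r ∈ {r : Fin m → ℝ | ∀ j, r j ∈ Ioo 0 T} :=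
          ⟨fun h j => by simpa using h (σ.symm j), fun h j => h (σ j)⟩
        have e2 : ∀ ω, ∏ j, f (Y ((r ∘ σ) j) ω) = ∏ j, f (Y (r j) ω) := fun ω =>
          Equiv.prod_comp σ fun j => f (Y (r j) ω)
        classical
        simp only [indicator_apply, e1, e2]

theorem moment_bound {Ω : Type*} [MeasurableSpace Ω] {P : Measure Ω}
    [IsProbabilityMeasure P] {d m : ℕ} (hm : Even m) {Y : ℝ → Ω → Ed d}
    (hY : Measurable (Function.uncurry Y)) {T α γ K : ℝ} (hα : 0 < α) (hγ0 : 0 ≤ γ) (hγ1 : γ ≤ 1)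
    (hαγ : α * (1 + 2 * γ) * d < 1)
    (hK : ∀ r : Fin m → ℝ, StrictMono r → (∀ j, 0 < r j) → (∀ j, r j < T) →
      ∀ u : Fin m → Ed d,
        ‖∫ ω, Complex.exp (Complex.I * Complex.ofReal (∑ j, 2 * Real.pi * ⟪u j, Y (r j) ω⟫)) ∂P‖ₑ ≤
        ENNReal.ofReal K * ∏ j, ∏ l, decayProfile (gap r j ^ α) ((∑ i ∈ Finset.Ici j, u i) l)) :
    ∃ C : ENNReal, C ≠ ⊤ ∧ ∀ (A : ENNReal) (f : Ed d → ℝ) (g : Ed d → ℂ), Measurable f →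
      Integrable g →
      (∀ y, (f y : ℂ) =
        ∫ w, Complex.exp (Complex.I * Complex.ofReal (2 * Real.pi * ⟪w, y⟫)) * g w) →
      (∀ w, ‖g w‖ₑ ≤ A * freqWeight γ w) → ∀ t ≤ T,
      ∫⁻ ω, ENNReal.ofReal ((∫ r in Ioo 0 t, f (Y r ω)) ^ m) ∂P ≤ C * A ^ m := by
  obtain ⟨C, hC, hCb⟩ := lintegral_freqWeight_mul_charFun (m := m) (d := d) (T := T) hα hγ0 hγ1
  have hYr : ∀ r, Measurable (Y r) := fun r => hY.comp measurable_prodMk_left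
  have hfin := lintegral_simplex_gap_lt_top (m := m) (T := T) C hC hαγ
  set S := ∫⁻ r : Fin m → ℝ in {r | StrictMono r}, {r : Fin m → ℝ | ∀ j, r j ∈ Ioo 0 T}.indicator
      (fun r => ∏ j, ENNReal.ofReal (C * gap r j ^ (-(α * (1 + 2 * γ)))) ^ d) r with hS
  refine ⟨m.factorial * (ENNReal.ofReal K * S), by finiteness, ?_⟩
  intro A f g hf hg hfg hgA t htT
  have hM : ∀ y, |f y| ≤ ∫ w, ‖g w‖ := by
    intro y
    have : |f y| = ‖(f y : ℂ)‖ := by simp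
    rw [this, hfg]
    refine (norm_integral_le_integral_norm _).trans (le_of_eq ?_)
    congr 1 with w
    rw [norm_mul, mul_comm Complex.I, Complex.norm_exp_ofReal_mul_I, one_mul]
  refine (moment_le_lintegral_simplex hm hY hf hM htT).trans ?_
  have hSM : MeasurableSet {r : Fin m → ℝ | StrictMono r} := by
    have : {r : Fin m → ℝ | StrictMono r} = ⋂ i, ⋂ j, ⋂ _ : i < j, {r | r i < r j} := by
      ext r; simp [StrictMono]
    rw [this]
    refine .iInter fun i => .iInter fun j => .iInter fun _ => ?_
    exact measurableSet_lt (by fun_prop) (by fun_prop)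
  have hgapm : ∀ j : Fin m, Measurable fun r : Fin m → ℝ => gap r j := by
    intro j
    have : ∀ i : Fin (m + 1), Measurable
        (fun r : Fin m → ℝ => (Fin.cons 0 r : Fin (m + 1) → ℝ) i) := by
      intro i
      refine Fin.cases ?_ (fun j => ?_) i
      · simp
      · simp only [Fin.cons_succ]; fun_prop
    exact (this _).sub (this _)
  rw [mul_assoc, mul_assoc]
  gcongr
  have hstep : ∀ r ∈ {r : Fin m → ℝ | StrictMono r},
      {r : Fin m → ℝ | ∀ j, r j ∈ Ioo 0 T}.indicator
          (fun r => ‖∫ ω, ∏ j, f (Y (r j) ω) ∂P‖ₑ) r ≤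
      (A ^ m * ENNReal.ofReal K) * {r : Fin m → ℝ | ∀ j, r j ∈ Ioo 0 T}.indicator
      (fun r => ∏ j, ENNReal.ofReal (C * gap r j ^ (-(α * (1 + 2 * γ)))) ^ d) r := by
    intro r hr
    refine indicator_apply_le' (fun hrT => ?_) (fun _ => zero_le)
    rw [indicator_of_mem hrT]
    have h0 : ∀ j, 0 < r j := fun j => (hrT j).1
    have h1 : ∀ j, r j < T := fun j => (hrT j).2
    refine (enorm_integral_prod_le hg hfg fun j => hYr (r j)).trans ?_
    calc _ ≤ ∫⁻ u : Fin m → Ed d, A ^ m * ((∏ j, freqWeight γ (u j)) *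
          ‖∫ ω, Complex.exp (Complex.I * Complex.ofReal
            (∑ j, 2 * Real.pi * ⟪u j, Y (r j) ω⟫)) ∂P‖ₑ) := by
          refine lintegral_mono fun u => ?_
          rw [← mul_assoc]
          gcongr
          calc ∏ j, ‖g (u j)‖ₑ ≤ ∏ j, (A * freqWeight γ (u j)) := by
                gcongr with j _
                exact hgA _
            _ = _ := by simp [Finset.prod_mul_distrib]
      _ = A ^ m * ∫⁻ u : Fin m → Ed d, ((∏ j, freqWeight γ (u j)) *
          ‖∫ ω, Complex.exp (Complex.I * Complex.ofReal
            (∑ j, 2 * Real.pi * ⟪u j, Y (r j) ω⟫)) ∂P‖ₑ) := by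
          refine lintegral_const_mul _ ?_
          refine Measurable.mul ?_ ?_
          · unfold freqWeight; fun_prop
          · refine Measurable.enorm (StronglyMeasurable.integral_prod_right
              (f := fun (u : Fin m → Ed d) (ω : Ω) => Complex.exp (Complex.I * Complex.ofReal
                (∑ j, 2 * Real.pi * ⟪u j, Y (r j) ω⟫))) ?_).measurable
            refine Measurable.stronglyMeasurable ?_
            have : ∀ j, Measurable fun p : (Fin m → Ed d) × Ω => Y (r j) p.2 := fun j =>
              (hYr (r j)).comp measurable_snd
            simp only [Function.uncurry_def]
            fun_prop
      _ ≤ A ^ m * (ENNReal.ofReal K *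
            ∏ j, ENNReal.ofReal (C * gap r j ^ (-(α * (1 + 2 * γ)))) ^ d) := by
          gcongr
          exact hCb _ r hr h0 h1 _ (hK r hr h0 h1)
      _ = _ := by ring
  refine (setLIntegral_mono' hSM hstep).trans ?_
  rw [lintegral_const_mul]
  · apply le_of_eq
    rw [hS]; ring
  · refine Measurable.indicator ?_ ?_
    · refine Finset.measurable_prod _ fun j _ => ?_
      have := hgapm j
      fun_prop
    · simp only [ofPred_forall]
      exact MeasurableSet.iInter fun j => measurableSet_Ioo.preimage (measurable_pi_apply j)

/-- The Gaussian density on `ℝ^d` whose Fourier transform is `w ↦ exp (-‖w‖² / s²)`. -/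
def gaussKernel {d : ℕ} (s : ℝ) (y : Ed d) : ℝ :=
  (√Real.pi * s) ^ d * Real.exp (-(Real.pi * s * ‖y‖) ^ 2)

theorem gaussKernel_nonneg {d : ℕ} {s : ℝ} (hs : 0 ≤ s) (y : Ed d) : 0 ≤ gaussKernel s y := by
  unfold gaussKernel; positivity

theorem continuous_gaussKernel {d : ℕ} (s : ℝ) : Continuous (gaussKernel (d := d) s) := by
  unfold gaussKernel; fun_prop

theorem gaussKernel_le {d : ℕ} {s : ℝ} (hs : 0 ≤ s) (y : Ed d) :
    gaussKernel s y ≤ (√Real.pi * s) ^ d := by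
  refine mul_le_of_le_one_right (by positivity) (Real.exp_le_one_iff.2 ?_)
  nlinarith [sq_nonneg (Real.pi * s * ‖y‖)]

theorem abs_exp_neg_sq_sub_le (a b : ℝ) :
    |Real.exp (-a ^ 2) - Real.exp (-b ^ 2)| ≤ |a - b| := by
  have h : LipschitzWith 1 fun x : ℝ => Real.exp (-x ^ 2) := by
    have hd : ∀ x : ℝ, HasDerivAt (fun x : ℝ => Real.exp (-x ^ 2))
        (Real.exp (-x ^ 2) * (-(2 * x))) x := by
      intro x
      simpa using ((hasDerivAt_pow 2 x).neg).exp
    refine lipschitzWith_of_nnnorm_deriv_le (fun x => (hd x).differentiableAt) fun x => ?_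
    rw [(hd x).deriv, ← NNReal.coe_le_coe, coe_nnnorm, norm_mul, norm_neg]
    simp only [Real.norm_eq_abs, Real.abs_exp, NNReal.coe_one]
    rw [Real.exp_neg, inv_mul_le_one₀ (Real.exp_pos _)]
    refine le_trans ?_ (Real.add_one_le_exp (x ^ 2))
    rw [abs_le]
    constructor <;> nlinarith [sq_nonneg (x - 1), sq_nonneg (x + 1)]
  simpa [Real.dist_eq] using h.dist_le_mul a b

theorem abs_gaussKernel_sub_le {d : ℕ} {s : ℝ} (hs : 0 ≤ s) (y z : Ed d) :
    |gaussKernel s y - gaussKernel s z| ≤ (√Real.pi * s) ^ d * (Real.pi * s) * ‖y - z‖ := by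
  unfold gaussKernel
  rw [← mul_sub, abs_mul, abs_of_nonneg (by positivity : 0 ≤ (√Real.pi * s) ^ d),
    mul_assoc ((√Real.pi * s) ^ d)]
  refine mul_le_mul_of_nonneg_left ?_ (by positivity)
  refine (abs_exp_neg_sq_sub_le _ _).trans ?_
  rw [← mul_sub, abs_mul, abs_of_nonneg (by positivity : 0 ≤ Real.pi * s)]
  gcongr
  exact abs_norm_sub_norm_le y z

theorem cpow_half_eq {s : ℝ} (hs : 0 < s) (d : ℕ) :
    ((Real.pi : ℂ) * (s : ℂ) ^ 2) ^ ((d : ℂ) / 2) = (((√Real.pi * s) ^ d : ℝ) : ℂ) := by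
  have h1 : ((Real.pi : ℂ) * (s : ℂ) ^ 2) = (((√Real.pi * s) ^ 2 : ℝ) : ℂ) := by
    rw [mul_pow, Real.sq_sqrt Real.pi_pos.le]; push_cast; rfl
  have h2 : ((d : ℂ) / 2) = (((d : ℝ) / 2 : ℝ) : ℂ) := by push_cast; rfl
  have h0 : 0 ≤ √Real.pi * s := by positivity
  rw [h1, h2, ← Complex.ofReal_cpow (by positivity)]
  congr 1
  rw [← Real.rpow_natCast _ 2, ← Real.rpow_mul h0, ← Real.rpow_natCast _ d]
  congr 1
  push_cast
  ring

theorem ofReal_gaussKernel {d : ℕ} {s : ℝ} (hs : 0 < s) (y : Ed d) :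
    (gaussKernel s y : ℂ) = ((Real.pi : ℂ) * (s : ℂ) ^ 2) ^ ((d : ℂ) / 2) *
      Complex.exp (-Real.pi ^ 2 * (s : ℂ) ^ 2 * ‖y‖ ^ 2) := by
  rw [cpow_half_eq hs, gaussKernel]
  push_cast
  congr 2
  ring

theorem integral_gaussKernel {d : ℕ} {s : ℝ} (hs : 0 < s) :
    ∫ y : Ed d, gaussKernel s y = 1 := by
  unfold gaussKernel
  rw [integral_const_mul]
  have h := GaussianFourier.integral_rexp_neg_mul_sq_norm (V := Ed d)
    (b := (Real.pi * s) ^ 2) (by positivity)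
  simp only [neg_mul, ← mul_pow] at h
  rw [h, finrank_euclideanSpace, Fintype.card_fin]
  have h0 : 0 < √Real.pi * s := by positivity
  have e : Real.pi / (Real.pi * s) ^ 2 = (√Real.pi * s)⁻¹ ^ 2 := by
    rw [inv_pow, mul_pow, mul_pow, Real.sq_sqrt Real.pi_pos.le]
    field_simp
  rw [e, ← Real.rpow_natCast _ 2, ← Real.rpow_mul (by positivity)]
  have : ((2 : ℕ) : ℝ) * ((d : ℝ) / 2) = (d : ℕ) := by push_cast; ring
  rw [this, Real.rpow_natCast, inv_pow, mul_inv_cancel₀ (by positivity)]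

theorem integrable_gaussKernel {d : ℕ} {s : ℝ} (hs : 0 < s) :
    Integrable (gaussKernel (d := d) s) :=
  integrable_of_integral_eq_one (integral_gaussKernel hs)

theorem integrable_exp_mul_gauss {d : ℕ} {s : ℝ} (hs : 0 < s) (y : Ed d) :
    Integrable fun w : Ed d => Complex.exp (Complex.I * Complex.ofReal (2 * Real.pi * ⟪w, y⟫)) *
      (Real.exp (-(‖w‖ / s) ^ 2) : ℂ) := by
  have h := GaussianFourier.integrable_cexp_neg_mul_sq_norm_add (V := Ed d)
    (b := ((s ^ 2)⁻¹ : ℝ)) (by rw [Complex.ofReal_re]; positivity)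
    (2 * Real.pi * Complex.I) y
  convert h using 2 with w
  rw [Complex.ofReal_exp, ← Complex.exp_add]
  congr 1
  rw [real_inner_comm]
  push_cast
  field_simp
  ring

theorem gaussKernel_eq_integral {d : ℕ} {s : ℝ} (hs : 0 < s) (y : Ed d) :
    (gaussKernel s y : ℂ) = ∫ w : Ed d,
      Complex.exp (Complex.I * Complex.ofReal (2 * Real.pi * ⟪w, y⟫)) *
        (Real.exp (-(‖w‖ / s) ^ 2) : ℂ) := by
  have h := GaussianFourier.integral_cexp_neg_mul_sq_norm_add (V := Ed d)
    (b := ((s ^ 2)⁻¹ : ℝ)) (by rw [Complex.ofReal_re]; positivity)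
    (2 * Real.pi * Complex.I) y
  have hs' : (s : ℂ) ≠ 0 := by exact_mod_cast hs.ne'
  rw [ofReal_gaussKernel hs]
  trans (∫ w : Ed d, Complex.exp (-((((s ^ 2)⁻¹ : ℝ)) : ℂ) * ‖w‖ ^ 2 +
    2 * Real.pi * Complex.I * ⟪y, w⟫))
  · rw [h, finrank_euclideanSpace, Fintype.card_fin]
    congr 2
    · push_cast; field_simp
    · push_cast
      field_simp
      rw [Complex.I_sq]
      ring
  · congr 1 with w
    rw [Complex.ofReal_exp, ← Complex.exp_add]
    congr 1
    rw [real_inner_comm]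
    push_cast
    field_simp
    ring

/-- The Fourier transform of the difference of two consecutive dyadic Gaussian kernels at `x`. -/
def gaussDiffFourier {d : ℕ} (s : ℝ) (x w : Ed d) : ℂ :=
  Complex.exp (Complex.I * Complex.ofReal (2 * Real.pi * ⟪w, -x⟫)) *
    ((Real.exp (-(‖w‖ / (2 * s)) ^ 2) : ℂ) - (Real.exp (-(‖w‖ / s) ^ 2) : ℂ))

theorem integrable_gaussDiffFourier {d : ℕ} {s : ℝ} (hs : 0 < s) (x : Ed d) :
    Integrable (gaussDiffFourier s x) := by
  unfold gaussDiffFourier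
  simp only [mul_sub]
  exact (integrable_exp_mul_gauss (by positivity) _).sub (integrable_exp_mul_gauss hs _)

theorem gaussKernel_sub_eq_integral {d : ℕ} {s : ℝ} (hs : 0 < s) (x y : Ed d) :
    ((gaussKernel (2 * s) (y - x) - gaussKernel s (y - x) : ℝ) : ℂ) = ∫ w : Ed d,
      Complex.exp (Complex.I * Complex.ofReal (2 * Real.pi * ⟪w, y⟫)) * gaussDiffFourier s x w := by
  rw [Complex.ofReal_sub, gaussKernel_eq_integral hs, gaussKernel_eq_integral (by positivity),
    ← integral_sub (integrable_exp_mul_gauss (by positivity) _) (integrable_exp_mul_gauss hs _)]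
  congr 1 with w
  rw [gaussDiffFourier, ← mul_assoc, ← Complex.exp_add, ← mul_sub, sub_eq_add_neg y x,
    inner_add_right]
  congr 2
  push_cast
  ring

theorem EuclideanSpace.norm_le_sum_abs {d : ℕ} (w : Ed d) : ‖w‖ ≤ ∑ l, |w l| := by
  rw [EuclideanSpace.norm_eq]
  refine Real.sqrt_le_iff.2 ⟨Finset.sum_nonneg fun _ _ => abs_nonneg _, ?_⟩
  exact Finset.sum_sq_le_sq_sum_of_nonneg fun _ _ => abs_nonneg _

theorem norm_le_prod_one_add {d : ℕ} (w : Ed d) : ‖w‖ ≤ ∏ l, (1 + |w l|) := by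
  have h : ∀ s : Finset (Fin d), 1 + ∑ l ∈ s, |w l| ≤ ∏ l ∈ s, (1 + |w l|) := by
    intro s
    induction s using Finset.induction_on with
    | empty => simp
    | insert a s ha ih =>
      rw [Finset.sum_insert ha, Finset.prod_insert ha]
      have : 0 ≤ ∑ l ∈ s, |w l| := Finset.sum_nonneg fun _ _ => abs_nonneg _
      nlinarith [abs_nonneg (w a), mul_nonneg (abs_nonneg (w a)) this]
  refine le_trans ?_ (h Finset.univ)
  linarith [EuclideanSpace.norm_le_sum_abs w]

theorem enorm_gaussDiffFourier_le {d : ℕ} {s γ : ℝ} (hs : 0 < s) (hγ0 : 0 ≤ γ) (hγ1 : γ ≤ 1)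
    (x w : Ed d) :
    ‖gaussDiffFourier s x w‖ₑ ≤ ENNReal.ofReal ((1 / s) ^ γ) * freqWeight γ w := by
  have h1 : ‖gaussDiffFourier s x w‖ =
      |Real.exp (-(‖w‖ / (2 * s)) ^ 2) - Real.exp (-(‖w‖ / s) ^ 2)| := by
    rw [gaussDiffFourier, norm_mul, mul_comm Complex.I, Complex.norm_exp_ofReal_mul_I, one_mul,
      ← Complex.ofReal_sub, Complex.norm_real, Real.norm_eq_abs]
  have h0 : 0 ≤ ‖w‖ / s := by positivity
  have h2 : ‖gaussDiffFourier s x w‖ ≤ (‖w‖ / s) ^ γ := by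
    rw [h1]
    rcases le_total (‖w‖ / s) 1 with h | h
    · refine (abs_exp_neg_sq_sub_le _ _).trans ?_
      have : ‖w‖ / (2 * s) = ‖w‖ / s / 2 := by field_simp
      rw [this, abs_sub_comm, abs_of_nonneg (by linarith)]
      refine le_trans (by linarith) (Real.self_le_rpow_of_le_one h0 h hγ1)
    · refine le_trans ?_ (Real.one_le_rpow h hγ0)
      have e1 := Real.exp_pos (-(‖w‖ / (2 * s)) ^ 2)
      have e2 := Real.exp_pos (-(‖w‖ / s) ^ 2)
      have e3 : Real.exp (-(‖w‖ / (2 * s)) ^ 2) ≤ 1 :=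
        Real.exp_le_one_iff.2 (by nlinarith [sq_nonneg (‖w‖ / (2 * s))])
      have e4 : Real.exp (-(‖w‖ / s) ^ 2) ≤ 1 :=
        Real.exp_le_one_iff.2 (by nlinarith [sq_nonneg (‖w‖ / s)])
      rw [abs_le]
      constructor <;> linarith
  rw [← ofReal_norm, freqWeight,
    ← ENNReal.ofReal_prod_of_nonneg (fun _ _ => by positivity), ← ENNReal.ofReal_mul (by positivity)]
  refine ENNReal.ofReal_le_ofReal (h2.trans ?_)
  rw [Real.finsetProd_rpow _ _ (fun _ _ => by positivity),
    ← Real.mul_rpow (by positivity) (Finset.prod_nonneg fun _ _ => by positivity)]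
  refine Real.rpow_le_rpow h0 ?_ hγ0
  rw [div_eq_inv_mul, one_div]
  exact mul_le_mul_of_nonneg_left (norm_le_prod_one_add w) (by positivity)

theorem tendsto_integral_gaussKernel_mul {d : ℕ} {f : Ed d → ℝ} (hf : Integrable f) {v : Ed d}
    (hv : ContinuousAt f v) :
    Tendsto (fun n : ℕ => ∫ w, gaussKernel (2 ^ n) (v - w) * f w) atTop (𝓝 (f v)) := by
  have h := Real.tendsto_integral_gaussian_smul' (f := fun w => (f w : ℂ)) (v := v)
    hf.ofReal (by fun_prop)
  have h2 := h.comp ((tendsto_pow_atTop_atTop_of_one_lt (r := (4 : ℝ)) (by norm_num)))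
  rw [← tendsto_ofReal_iff]
  convert h2 using 2 with n
  simp only [Function.comp]
  rw [finrank_euclideanSpace, Fintype.card_fin]
  have e : ((4 : ℝ) ^ n : ℝ) = (2 ^ n) ^ 2 := by rw [← pow_mul, mul_comm, pow_mul]; norm_num
  rw [← integral_complex_ofReal]
  congr 1 with w
  rw [e]
  have := ofReal_gaussKernel (d := d) (s := 2 ^ n) (by positivity) (v - w)
  push_cast at this ⊢
  rw [this, smul_eq_mul]

/-- Indices of the space-time grid of mesh `1 / N` covering `[-R, R]^d × [0, T]`. -/
def gridIndex (d R N : ℕ) (T : ℝ) : Finset ((Fin d → ℤ) × ℕ) :=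
  (Fintype.piFinset fun _ : Fin d => Finset.Icc (-(R * N : ℤ)) (R * N)) ×ˢ
    Finset.range (⌊T * N⌋₊ + 1)

/-- The spatial grid point with index `z` at mesh `1 / N`. -/
def gridPoint {d : ℕ} (N : ℕ) (z : Fin d → ℤ) : Ed d := WithLp.toLp 2 fun l => (z l : ℝ) / N

theorem card_gridIndex_le {d R N : ℕ} {T : ℝ} (hT : 0 ≤ T) (hN : 0 < N) :
    ((gridIndex d R N T).card : ℝ) ≤ (2 * R + 1) ^ d * (T + 1) * (N : ℝ) ^ (d + 1) := by
  have hN1 : (1 : ℝ) ≤ N := by exact_mod_cast hN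
  have h1 : ((gridIndex d R N T).card : ℝ) = (2 * R * N + 1) ^ d * (⌊T * N⌋₊ + 1) := by
    have : (Finset.Icc (-(R * N : ℤ)) (R * N)).card = 2 * R * N + 1 := by
      rw [Int.card_Icc]
      have : (R * N + 1 - -(R * N) : ℤ) = ((2 * R * N + 1 : ℕ) : ℤ) := by push_cast; ring
      rw [this, Int.toNat_natCast]
    simp [gridIndex, this]
  rw [h1, pow_succ]
  have h2 : (⌊T * N⌋₊ : ℝ) ≤ T * N := Nat.floor_le (by positivity)
  calc (2 * R * N + 1 : ℝ) ^ d * (⌊T * N⌋₊ + 1)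
      ≤ ((2 * R + 1) * N) ^ d * ((T + 1) * N) := by
        gcongr
        · nlinarith
        · nlinarith
    _ = _ := by rw [mul_pow]; ring

theorem exists_gridIndex_near {d R N : ℕ} {T : ℝ} (hN : 0 < N) {x : Ed d} (hx : ‖x‖ ≤ R) {t : ℝ}
    (ht : t ∈ Icc 0 T) :
    ∃ p ∈ gridIndex d R N T, (p.2 : ℝ) / N ∈ Icc 0 T ∧
      ‖x - gridPoint N p.1‖ + |t - p.2 / N| ≤ (d + 1) / N := by
  have hN0 : (0 : ℝ) < N := by exact_mod_cast hN
  have hj := Nat.floor_le (mul_nonneg ht.1 hN0.le)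
  have hj' := Nat.lt_floor_add_one (t * N)
  have hjt : (⌊t * N⌋₊ : ℝ) / N ≤ t := by rwa [div_le_iff₀ hN0]
  refine ⟨(fun l => ⌊x l * N⌋, ⌊t * N⌋₊), ?_, ⟨by positivity, hjt.trans ht.2⟩, ?_⟩
  · simp only [gridIndex, Finset.mem_product, Fintype.mem_piFinset, Finset.mem_Icc,
      Finset.mem_range]
    refine ⟨fun l => ?_, ?_⟩
    · have hl : |x l| ≤ R := (PiLp.norm_apply_le x l).trans hx
      rw [abs_le] at hl
      constructor
      · rw [Int.le_floor]
        push_cast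
        nlinarith
      · have : (⌊x l * N⌋ : ℝ) ≤ R * N := (Int.floor_le _).trans (by nlinarith)
        exact_mod_cast this
    · exact Nat.lt_succ_of_le (Nat.floor_le_floor (by gcongr; exact ht.2))
  · have h1 : ‖x - gridPoint N fun l => ⌊x l * N⌋‖ ≤ d / N := by
      refine (EuclideanSpace.norm_le_sum_abs _).trans ?_
      have : ∀ l, |(x - gridPoint N fun l => ⌊x l * N⌋) l| ≤ 1 / N := by
        intro l
        have f1 := Int.floor_le (x l * N)
        have f2 := (Int.lt_floor_add_one (x l * N)).le
        simp only [gridPoint, PiLp.sub_apply]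
        have e : x l - ⌊x l * N⌋ / N = (x l * N - ⌊x l * N⌋) / N := by field_simp
        rw [e, abs_of_nonneg (by apply div_nonneg <;> linarith)]
        gcongr
        linarith
      refine (Finset.sum_le_sum fun l _ => this l).trans (le_of_eq ?_)
      simp [div_eq_mul_inv]
    have h2 : |t - (⌊t * N⌋₊ : ℝ) / N| ≤ 1 / N := by
      rw [abs_of_nonneg (by linarith), sub_le_iff_le_add, ← add_div, le_div_iff₀ hN0]
      linarith
    rw [add_div]
    exact add_le_add h1 h2

theorem le_one_add_of_pow_le {a F : ℝ} (hF : 0 ≤ F) {k : ℕ} (hk : k ≠ 0) (h : a ^ k ≤ F) :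
    a ≤ 1 + F := by
  rcases le_total a 1 with h1 | h1
  · linarith
  · linarith [le_self_pow₀ h1 hk]

theorem ae_exists_bound_grid {Ω : Type*} [MeasurableSpace Ω] {P : Measure Ω} {d R b : ℕ}
    {T ρ : ℝ} (hT : 0 ≤ T) (hb : 0 < b) (hρ0 : 0 < ρ) (hρ1 : ρ < 1)
    {D : ℕ → Ω → Ed d → ℝ → ℝ} (hmeas : ∀ n x t, Measurable fun ω => D n ω x t)
    (hmom : ∀ k : ℕ, k ≠ 0 → ∃ C : ENNReal, C ≠ ⊤ ∧ ∀ n x, ∀ t ≤ T,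
      ∫⁻ ω, ENNReal.ofReal (D n ω x t ^ (2 * k)) ∂P ≤ C * ENNReal.ofReal ((ρ ^ 2) ^ n) ^ (2 * k)) :
    ∀ᵐ ω ∂P, ∃ C : ℝ, 0 ≤ C ∧ ∀ n, ∀ p ∈ gridIndex d R (b ^ n) T, (p.2 : ℝ) / (b ^ n : ℕ) ≤ T →
      |D n ω (gridPoint (b ^ n) p.1) (p.2 / (b ^ n : ℕ))| ≤ C * ρ ^ n := by
  have hb0 : (0 : ℝ) < b := by exact_mod_cast hb
  obtain ⟨k, hk0, hk⟩ : ∃ k : ℕ, k ≠ 0 ∧ (b : ℝ) ^ (d + 1) * ρ ^ (2 * k) < 1 := by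
    have h1 : Tendsto (fun k : ℕ => (b : ℝ) ^ (d + 1) * (ρ ^ 2) ^ k) atTop (𝓝 0) := by
      simpa using (tendsto_pow_atTop_nhds_zero_of_lt_one (by positivity)
        (by nlinarith : ρ ^ 2 < 1)).const_mul ((b : ℝ) ^ (d + 1))
    obtain ⟨k, h, h'⟩ := ((h1.eventually_lt_const one_pos).and (eventually_ne_atTop 0)).exists
    exact ⟨k, h', by rwa [pow_mul]⟩
  obtain ⟨C, hC, hCb⟩ := hmom k hk0
  let G : ℕ → Finset ((Fin d → ℤ) × ℕ) := fun n =>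
    (gridIndex d R (b ^ n) T).filter fun p => (p.2 : ℝ) / (b ^ n : ℕ) ≤ T
  let F : ℕ → (Fin d → ℤ) × ℕ → Ω → ENNReal := fun n p ω => ENNReal.ofReal
    ((D n ω (gridPoint (b ^ n) p.1) (p.2 / (b ^ n : ℕ)) / ρ ^ n) ^ (2 * k))
  have hFm : ∀ n p, Measurable (F n p) := fun n p =>
    (((hmeas n _ _).div_const _).pow_const _).ennreal_ofReal
  have hFi : ∀ n, ∀ p ∈ G n, ∫⁻ ω, F n p ω ∂P ≤ C * ENNReal.ofReal ((ρ ^ (2 * k)) ^ n) := by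
    intro n p hp
    have e : ∀ ω, F n p ω = ENNReal.ofReal ((ρ ^ n)⁻¹ ^ (2 * k)) * ENNReal.ofReal
        (D n ω (gridPoint (b ^ n) p.1) (p.2 / (b ^ n : ℕ)) ^ (2 * k)) := by
      intro ω
      simp only [F]
      rw [← ENNReal.ofReal_mul (by positivity), div_eq_inv_mul, mul_pow]
    simp only [e]
    rw [lintegral_const_mul' _ _ ENNReal.ofReal_ne_top]
    calc _ ≤ ENNReal.ofReal ((ρ ^ n)⁻¹ ^ (2 * k)) *
          (C * ENNReal.ofReal ((ρ ^ 2) ^ n) ^ (2 * k)) := by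
          gcongr
          exact hCb n _ _ (Finset.mem_filter.1 hp).2
      _ = C * ENNReal.ofReal ((ρ ^ (2 * k)) ^ n) := by
          rw [← ENNReal.ofReal_pow (by positivity), mul_left_comm,
            ← ENNReal.ofReal_mul (by positivity), ← mul_pow]
          have : (ρ ^ n)⁻¹ * (ρ ^ 2) ^ n = ρ ^ n := by
            rw [← pow_mul, mul_comm 2 n, pow_mul, sq]
            field_simp
          rw [this, ← pow_mul, ← pow_mul, mul_comm n]
  have hcard : ∀ n, ((G n).card : ENNReal) ≤
      ENNReal.ofReal ((2 * R + 1) ^ d * (T + 1) * ((b : ℝ) ^ (d + 1)) ^ n) := by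
    intro n
    rw [← ENNReal.ofReal_natCast]
    refine ENNReal.ofReal_le_ofReal ?_
    calc ((G n).card : ℝ) ≤ ((gridIndex d R (b ^ n) T).card : ℝ) := by
          exact_mod_cast Finset.card_filter_le _ _
      _ ≤ _ := card_gridIndex_le hT (by positivity)
      _ = _ := by push_cast; rw [← pow_mul, ← pow_mul, mul_comm n]
  have hfin : ∫⁻ ω, ∑' n, ∑ p ∈ G n, F n p ω ∂P ≠ ⊤ := by
    rw [lintegral_tsum fun n => (Finset.measurable_fun_sum _ fun p _ => hFm n p).aemeasurable]
    have hle : ∀ n, ∫⁻ ω, ∑ p ∈ G n, F n p ω ∂P ≤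
        ENNReal.ofReal ((2 * R + 1) ^ d * (T + 1)) * C *
          ENNReal.ofReal (b ^ (d + 1) * ρ ^ (2 * k)) ^ n := by
      intro n
      rw [lintegral_finsetSum _ fun p _ => hFm n p]
      refine (Finset.sum_le_sum fun p hp => hFi n p hp).trans ?_
      rw [Finset.sum_const, nsmul_eq_mul]
      refine (mul_le_mul_left (hcard n) _).trans (le_of_eq ?_)
      rw [← ENNReal.ofReal_pow (by positivity), mul_pow, ENNReal.ofReal_mul (by positivity),
        ENNReal.ofReal_mul (p := ((b : ℝ) ^ (d + 1)) ^ n) (by positivity)]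
      ring
    refine ne_top_of_le_ne_top ?_ (ENNReal.tsum_le_tsum hle)
    rw [ENNReal.tsum_mul_left, ENNReal.tsum_geometric]
    have h1 : ENNReal.ofReal (b ^ (d + 1) * ρ ^ (2 * k)) < 1 := by
      rwa [ENNReal.ofReal_lt_one]
    have : (1 - ENNReal.ofReal (b ^ (d + 1) * ρ ^ (2 * k)))⁻¹ ≠ ⊤ := by
      rw [ENNReal.inv_ne_top]
      exact (tsub_pos_of_lt h1).ne'
    finiteness
  have hmeasF : Measurable fun ω => ∑' n, ∑ p ∈ G n, F n p ω :=
    Measurable.tsum fun n => Finset.measurable_fun_sum _ fun p _ => hFm n p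
  filter_upwards [ae_lt_top hmeasF hfin] with ω hω
  refine ⟨1 + (∑' n, ∑ p ∈ G n, F n p ω).toReal, by positivity, fun n p hp hpT => ?_⟩
  rw [← div_le_iff₀ (by positivity)]
  refine le_one_add_of_pow_le ENNReal.toReal_nonneg (k := 2 * k) (by omega) ?_
  rw [← ENNReal.ofReal_le_iff_le_toReal hω.ne]
  have h1 : F n p ω ≤ ∑' n, ∑ p ∈ G n, F n p ω :=
    (Finset.single_le_sum (f := fun p => F n p ω) (fun _ _ => zero_le)
      (Finset.mem_filter.2 ⟨hp, hpT⟩)).trans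
      (ENNReal.le_tsum (f := fun n => ∑ p ∈ G n, F n p ω) n)
  refine le_trans (le_of_eq ?_) h1
  simp only [F]
  congr 1
  rw [div_pow, div_pow, Even.pow_abs ⟨k, by ring⟩]

theorem ae_exists_bound_of_moments {Ω : Type*} [MeasurableSpace Ω] {P : Measure Ω} {d B : ℕ}
    {T ρ M : ℝ} (hT : 0 ≤ T) (hB : 0 < B) (hρ0 : 0 < ρ) (hρ1 : ρ < 1) (hM : 0 ≤ M)
    {D : ℕ → Ω → Ed d → ℝ → ℝ} (hmeas : ∀ n x t, Measurable fun ω => D n ω x t)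
    (hmom : ∀ k : ℕ, k ≠ 0 → ∃ C : ENNReal, C ≠ ⊤ ∧ ∀ n x, ∀ t ≤ T,
      ∫⁻ ω, ENNReal.ofReal (D n ω x t ^ (2 * k)) ∂P ≤ C * ENNReal.ofReal ((ρ ^ 2) ^ n) ^ (2 * k))
    (hlip : ∀ n ω x y, ∀ s ∈ Icc 0 T, ∀ t ∈ Icc 0 T,
      |D n ω x s - D n ω y t| ≤ M * B ^ n * (‖x - y‖ + |s - t|)) :
    ∀ᵐ ω ∂P, ∀ R : ℕ, ∃ C : ℝ, 0 ≤ C ∧ ∀ n x, ‖x‖ ≤ R → ∀ t ∈ Icc 0 T,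
      |D n ω x t| ≤ C * ρ ^ n := by
  obtain ⟨b, hb⟩ := exists_nat_ge (1 / ρ)
  have hb0 : (0 : ℝ) < b := lt_of_lt_of_le (by positivity) hb
  have hbN : 0 < b := by exact_mod_cast hb0
  have hB0 : (0 : ℝ) < B := by exact_mod_cast hB
  rw [ae_all_iff]
  intro R
  filter_upwards [ae_exists_bound_grid (R := R) (b := B * b) hT (by positivity) hρ0 hρ1 hmeas hmom]
    with ω ⟨C, hC, hCb⟩
  refine ⟨C + M * (d + 1), by positivity, fun n x hx t ht => ?_⟩
  obtain ⟨p, hp, hpT, hpx⟩ := exists_gridIndex_near (N := (B * b) ^ n) (by positivity) hx ht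
  have h1 := hCb n p hp hpT.2
  have h2 := hlip n ω x (gridPoint ((B * b) ^ n) p.1) t ht _ hpT
  have h3 : M * B ^ n * (‖x - gridPoint ((B * b) ^ n) p.1‖ + |t - p.2 / ((B * b) ^ n : ℕ)|) ≤
      M * (d + 1) * ρ ^ n := by
    calc _ ≤ M * B ^ n * ((d + 1) / ((B * b) ^ n : ℕ)) := by gcongr
      _ = M * (d + 1) * (1 / b) ^ n := by
          rw [Nat.cast_pow, Nat.cast_mul, mul_pow, one_div_pow]
          field_simp
      _ ≤ _ := by
          gcongr
          rw [div_le_comm₀ hb0 hρ0]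
          exact hb
  have h4 := abs_sub_abs_le_abs_sub (D n ω x t)
    (D n ω (gridPoint ((B * b) ^ n) p.1) (p.2 / ((B * b) ^ n : ℕ)))
  linarith

theorem le_rpow_mul_rpow_of_le {a U V lam : ℝ} (ha : 0 ≤ a) (hl0 : 0 < lam) (hl1 : lam < 1)
    (hU : a ≤ U) (hV : a ≤ V) : a ≤ U ^ (1 - lam) * V ^ lam := by
  calc a = a ^ (1 - lam) * a ^ lam := by
        rw [← Real.rpow_add' ha (by norm_num)]
        simp
    _ ≤ _ := by
        have : 0 ≤ 1 - lam := by linarith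
        gcongr
        exact Real.rpow_nonneg (ha.trans hU) _

theorem exists_rpow_mul_rpow_lt_one {ρ B : ℝ} (hρ0 : 0 < ρ) (hρ1 : ρ < 1) (hB : 0 < B) :
    ∃ lam : ℝ, 0 < lam ∧ lam < 1 ∧ ρ ^ (1 - lam) * B ^ lam < 1 := by
  have h : ContinuousAt (fun lam : ℝ => ρ ^ (1 - lam) * B ^ lam) 0 := by
    refine ContinuousAt.mul ?_ ?_
    · exact (Real.continuousAt_const_rpow hρ0.ne').comp (by fun_prop)
    · exact Real.continuousAt_const_rpow hB.ne'
  have h1 : ∀ᶠ lam in 𝓝 (0 : ℝ), ρ ^ (1 - lam) * B ^ lam < 1 := by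
    refine h.eventually_lt_const ?_
    simpa using hρ1
  have h2 : ∀ᶠ lam in 𝓝[>] (0 : ℝ), lam < 1 :=
    (eventually_lt_nhds one_pos).filter_mono nhdsWithin_le_nhds
  obtain ⟨lam, hl, hl1, hl0⟩ := ((h1.filter_mono nhdsWithin_le_nhds).and
    (h2.and self_mem_nhdsWithin)).exists
  exact ⟨lam, hl0, hl1, hl⟩

/-- A sequence converging geometrically fast, whose Lipschitz constants grow at most
geometrically, has a Hölder continuous limit. -/
theorem exists_holder_of_geometric_approx {E : Type*} {S : Set E} {δ : E → E → ℝ}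
    (hδ : ∀ p q, 0 ≤ δ p q) {L : ℕ → E → ℝ} {l : E → ℝ} {ρ B M C₀ C lam : ℝ}
    (hl : ∀ p ∈ S, Tendsto (fun n => L n p) atTop (𝓝 (l p)))
    (hρ0 : 0 < ρ) (hB : 1 ≤ B) (hM : 0 ≤ M) (hC₀ : 0 ≤ C₀) (hC : 0 ≤ C)
    (hl0 : 0 < lam) (hl1 : lam < 1) (hlam : ρ ^ (1 - lam) * B ^ lam < 1)
    (hL0 : ∀ p ∈ S, |L 0 p| ≤ C₀)
    (hstep : ∀ n, ∀ p ∈ S, |L (n + 1) p - L n p| ≤ C * ρ ^ n)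
    (hlip : ∀ n, ∀ p ∈ S, ∀ q ∈ S, |L n p - L n q| ≤ M * B ^ n * δ p q) :
    ∃ η : ℝ, 0 ≤ η ∧ ∀ p ∈ S, ∀ q ∈ S, |l p - l q| ≤ η * δ p q ^ lam := by
  set κ := ρ ^ (1 - lam) * B ^ lam with hκ
  have hB0 : 0 < B := by linarith
  have hκ0 : 0 ≤ κ := by positivity
  set a := (2 * C₀) ^ (1 - lam) * M ^ lam with ha
  set b := (2 * C) ^ (1 - lam) * (2 * M * B) ^ lam with hb
  have ha0 : 0 ≤ a := by positivity
  have hb0 : 0 ≤ b := by positivity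
  have h1κ : 0 < 1 - κ := by linarith
  refine ⟨a + b * (1 - κ)⁻¹, by positivity, fun p hp q hq => ?_⟩
  have hd := hδ p q
  have h0 : |L 0 p - L 0 q| ≤ a * δ p q ^ lam := by
    have h1 : |L 0 p - L 0 q| ≤ 2 * C₀ := by
      have := abs_sub (L 0 p) (L 0 q)
      linarith [hL0 p hp, hL0 q hq]
    have h2 : |L 0 p - L 0 q| ≤ M * δ p q := by simpa using hlip 0 p hp q hq
    refine (le_rpow_mul_rpow_of_le (abs_nonneg _) hl0 hl1 h1 h2).trans (le_of_eq ?_)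
    rw [Real.mul_rpow hM hd, ha]; ring
  have hs : ∀ n, |(L (n + 1) p - L n p) - (L (n + 1) q - L n q)| ≤ b * κ ^ n * δ p q ^ lam := by
    intro n
    have h1 : |(L (n + 1) p - L n p) - (L (n + 1) q - L n q)| ≤ (2 * C) * ρ ^ n := by
      have := abs_sub (L (n + 1) p - L n p) (L (n + 1) q - L n q)
      linarith [hstep n p hp, hstep n q hq]
    have h2 : |(L (n + 1) p - L n p) - (L (n + 1) q - L n q)| ≤ (2 * M * B) * B ^ n * δ p q := by
      have e : (L (n + 1) p - L n p) - (L (n + 1) q - L n q) =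
        (L (n + 1) p - L (n + 1) q) - (L n p - L n q) := by ring
      rw [e]
      refine (abs_sub _ _).trans ?_
      have e1 := hlip (n + 1) p hp q hq
      have e2 := hlip n p hp q hq
      have e3 : M * B ^ n * δ p q ≤ M * B ^ (n + 1) * δ p q := by
        gcongr
        omega
      rw [pow_succ] at e1 e3
      linarith
    refine (le_rpow_mul_rpow_of_le (abs_nonneg _) hl0 hl1 h1 h2).trans (le_of_eq ?_)
    rw [Real.mul_rpow (by positivity) hd, Real.mul_rpow (x := 2 * C) (by positivity) (by positivity),
      Real.mul_rpow (x := 2 * M * B) (by positivity) (by positivity), ← Real.rpow_pow_comm hρ0.le,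
      ← Real.rpow_pow_comm hB0.le, hκ, mul_pow, hb]
    ring
  have hn : ∀ n, |L n p - L n q| ≤ (a + b * ∑ i ∈ Finset.range n, κ ^ i) * δ p q ^ lam := by
    intro n
    induction n with
    | zero => simpa using h0
    | succ n ih =>
      have e : L (n + 1) p - L (n + 1) q =
        (L n p - L n q) + ((L (n + 1) p - L n p) - (L (n + 1) q - L n q)) := by ring
      rw [e, Finset.sum_range_succ]
      refine (abs_add_le _ _).trans ((add_le_add ih (hs n)).trans (le_of_eq ?_))
      ring
  refine le_of_tendsto ((hl p hp).sub (hl q hq)).abs (Eventually.of_forall fun n => ?_)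
  refine (hn n).trans ?_
  gcongr
  rw [← tsum_geometric_of_lt_one hκ0 hlam]
  exact (summable_geometric_of_lt_one hκ0 hlam).sum_le_tsum _ fun _ _ => by positivity

theorem rpow_add_le_add_rpow {a b lam : ℝ} (ha : 0 ≤ a) (hb : 0 ≤ b) (hl0 : 0 ≤ lam)
    (hl1 : lam ≤ 1) : (a + b) ^ lam ≤ a ^ lam + b ^ lam := by
  lift a to NNReal using ha
  lift b to NNReal using hb
  exact_mod_cast NNReal.rpow_add_le_add_rpow a b hl0 hl1

/-- The Gaussian regularisation at scale `2⁻ⁿ` of the occupation density on `(0, t)` of `y`. -/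
def smoothOcc {d : ℕ} (y : ℝ → Ed d) (n : ℕ) (x : Ed d) (t : ℝ) : ℝ :=
  ∫ r in Ioo 0 t, gaussKernel (2 ^ n) (y r - x)

section

variable {d : ℕ} {y : ℝ → Ed d}

theorem smoothOcc_nonneg (n : ℕ) (x : Ed d) (t : ℝ) : 0 ≤ smoothOcc y n x t :=
  integral_nonneg fun _ => gaussKernel_nonneg (by positivity) _

theorem integrableOn_gaussKernel_path (hy : Measurable y) (s : ℝ) (hs : 0 ≤ s) (x : Ed d)
    (a b : ℝ) : IntegrableOn (fun r => gaussKernel s (y r - x)) (Ioo a b) := by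
  refine Measure.integrableOn_of_bounded (M := (√Real.pi * s) ^ d) (by simp) ?_
    (ae_of_all _ fun r => ?_)
  · exact ((continuous_gaussKernel s).measurable.comp (hy.sub_const x)).aestronglyMeasurable
  · rw [Real.norm_of_nonneg (gaussKernel_nonneg hs _)]
    exact gaussKernel_le hs _

theorem tendsto_integral_smoothOcc_mul (hy : Measurable y) (t : ℝ) {ψ : Ed d → ℝ}
    (hψ : Continuous ψ) (hψc : HasCompactSupport ψ) :
    Tendsto (fun n => ∫ x, smoothOcc y n x t * ψ x) atTop (𝓝 (∫ r in Ioo 0 t, ψ (y r))) := by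
  have hψi : Integrable ψ := hψ.integrable_of_hasCompactSupport hψc
  obtain ⟨A, hA⟩ := hψc.exists_bound_of_continuous hψ
  have hfub : ∀ n, ∫ x, smoothOcc y n x t * ψ x =
      ∫ r in Ioo 0 t, ∫ x, gaussKernel (2 ^ n) (y r - x) * ψ x := by
    intro n
    simp only [smoothOcc, ← integral_mul_const]
    refine integral_integral_swap
      (f := fun (x : Ed d) (r : ℝ) => gaussKernel (2 ^ n) (y r - x) * ψ x) ?_
    have h1 : Integrable (fun p : Ed d × ℝ => ψ p.1)
        (volume.prod (volume.restrict (Ioo 0 t))) := hψi.comp_fst _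
    refine h1.bdd_mul (c := (√Real.pi * 2 ^ n) ^ d) ?_ (ae_of_all _ fun p => ?_)
    · refine Measurable.aestronglyMeasurable ?_
      have := (continuous_gaussKernel (d := d) (2 ^ n)).measurable
      fun_prop
    · rw [Real.norm_of_nonneg (gaussKernel_nonneg (by positivity) _)]
      exact gaussKernel_le (by positivity) _
  simp only [hfub]
  have : IsFiniteMeasure (volume.restrict (Ioo 0 t)) := ⟨by simp⟩
  refine tendsto_integral_of_dominated_convergence (fun _ => A) (fun n => ?_)
    (integrable_const _) (fun n => ae_of_all _ fun r => ?_) (ae_of_all _ fun r => ?_)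
  · refine (StronglyMeasurable.integral_prod_right
      (f := fun (r : ℝ) (x : Ed d) => gaussKernel (2 ^ n) (y r - x) * ψ x) ?_).aestronglyMeasurable
    refine Measurable.stronglyMeasurable ?_
    have := (continuous_gaussKernel (d := d) (2 ^ n)).measurable
    have := hψ.measurable
    simp only [Function.uncurry_def]
    fun_prop
  · have hg : Integrable fun x => gaussKernel (2 ^ n) (y r - x) :=
      (integrable_gaussKernel (d := d) (s := 2 ^ n) (by positivity)).comp_sub_left (y r)
    calc ‖∫ x, gaussKernel (2 ^ n) (y r - x) * ψ x‖
        ≤ ∫ x, gaussKernel (2 ^ n) (y r - x) * A := by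
          refine norm_integral_le_of_norm_le (hg.mul_const A) (ae_of_all _ fun x => ?_)
          rw [norm_mul, Real.norm_of_nonneg (gaussKernel_nonneg (by positivity) _)]
          exact mul_le_mul_of_nonneg_left (hA x) (gaussKernel_nonneg (by positivity) _)
      _ = A := by
          rw [integral_mul_const, integral_sub_left_eq_self (gaussKernel (d := d) (2 ^ n)),
            integral_gaussKernel (by positivity), one_mul]
  · exact tendsto_integral_gaussKernel_mul hψi hψ.continuousAt

theorem occupation_eq_of_tendsto (hy : Measurable y) {t ρ : ℝ} (hρ0 : 0 ≤ ρ) (hρ1 : ρ < 1)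
    {l : Ed d → ℝ} (hl : Continuous l)
    (hconv : ∀ R : ℕ, ∃ C : ℝ, ∀ n x, ‖x‖ ≤ R → |smoothOcc y n x t - l x| ≤ C * ρ ^ n)
    {A : Set (Ed d)} (hA : MeasurableSet A) :
    volume (Icc 0 t ∩ {r | y r ∈ A}) = ENNReal.ofReal (∫ x in A, l x) := by
  have hρ := tendsto_pow_atTop_nhds_zero_of_lt_one hρ0 hρ1
  have hpt : ∀ x, Tendsto (fun n => smoothOcc y n x t) atTop (𝓝 (l x)) := by
    intro x
    obtain ⟨R, hR⟩ := exists_nat_ge ‖x‖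
    obtain ⟨C, hC⟩ := hconv R
    rw [tendsto_iff_norm_sub_tendsto_zero]
    refine squeeze_zero (fun _ => norm_nonneg _) (fun n => hC n x hR) ?_
    simpa using hρ.const_mul C
  have hl0 : ∀ x, 0 ≤ l x := fun x => ge_of_tendsto' (hpt x) fun n => smoothOcc_nonneg n x t
  have : IsFiniteMeasure (volume.restrict (Ioo 0 t)) := ⟨by simp⟩
  set ν : Measure (Ed d) := volume.withDensity fun x => ENNReal.ofReal (l x) with hν
  have : IsLocallyFiniteMeasure ν := IsLocallyFiniteMeasure.withDensity_ofReal hl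
  have hψν : ∀ ψ : Ed d → ℝ, ∫ x, ψ x ∂ν = ∫ x, l x * ψ x := by
    intro ψ
    rw [hν, integral_withDensity_eq_integral_toReal_smul (by fun_prop) (by simp)]
    simp [ENNReal.toReal_ofReal (hl0 _)]
  have hμν : (volume.restrict (Ioo 0 t)).map y = ν := by
    refine Measure.ext_of_integral_eq_on_compactlySupported fun ψ => ?_
    have hψ : Continuous ψ := ψ.continuous
    rw [integral_map hy.aemeasurable hψ.aestronglyMeasurable, hψν]
    refine tendsto_nhds_unique (tendsto_integral_smoothOcc_mul hy t hψ ψ.hasCompactSupport) ?_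
    obtain ⟨R₀, hR₀⟩ := ψ.hasCompactSupport.isCompact.isBounded.exists_norm_le
    obtain ⟨R, hR⟩ := exists_nat_ge R₀
    obtain ⟨C, hC⟩ := hconv R
    have hψi : Integrable ψ := hψ.integrable_of_hasCompactSupport ψ.hasCompactSupport
    have hlψ : Integrable fun x => l x * ψ x :=
      (hl.mul hψ).integrable_of_hasCompactSupport ψ.hasCompactSupport.mul_left
    have hC' : ∀ n x, |smoothOcc y n x t * ψ x - l x * ψ x| ≤ C * ρ ^ n * |ψ x| := by
      intro n x
      rw [← sub_mul, abs_mul]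
      by_cases hx : ψ x = 0
      · simp [hx]
      · gcongr
        exact hC n x ((hR₀ x (subset_tsupport _ hx)).trans hR)
    refine tendsto_integral_of_dominated_convergence (fun x => |l x * ψ x| + C * |ψ x|)
      (fun n => ?_) (hlψ.abs.add (hψi.abs.const_mul C)) (fun n => ae_of_all _ fun x => ?_)
      (ae_of_all _ fun x => (hpt x).mul_const _)
    · refine AEStronglyMeasurable.mul ?_ hψ.aestronglyMeasurable
      refine (StronglyMeasurable.integral_prod_right
        (f := fun (x : Ed d) (r : ℝ) => gaussKernel (2 ^ n) (y r - x)) ?_).aestronglyMeasurable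
      refine Measurable.stronglyMeasurable ?_
      have := (continuous_gaussKernel (d := d) (2 ^ n)).measurable
      simp only [Function.uncurry_def]
      fun_prop
    · have h1 := hC' n x
      have h2 : C * ρ ^ n * |ψ x| ≤ C * |ψ x| := by
        by_cases hx : ψ x = 0
        · simp [hx]
        · have hC0 : 0 ≤ C := by
            simpa using (abs_nonneg _).trans
              (hC 0 x ((hR₀ x (subset_tsupport _ hx)).trans hR))
          gcongr
          exact mul_le_of_le_one_right hC0 (pow_le_one₀ hρ0 hρ1.le)
      have h3 := abs_sub_abs_le_abs_sub (smoothOcc y n x t * ψ x) (l x * ψ x)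
      rw [Real.norm_eq_abs]
      linarith
  have hli : Integrable l := by
    refine ⟨hl.aestronglyMeasurable, ?_⟩
    rw [hasFiniteIntegral_iff_ofReal (ae_of_all _ hl0), ← setLIntegral_univ,
      ← withDensity_apply _ MeasurableSet.univ, ← hν, ← hμν,
      Measure.map_apply hy MeasurableSet.univ]
    exact measure_lt_top _ _
  have hvol : volume (Icc 0 t ∩ {r | y r ∈ A}) = (volume.restrict (Ioo 0 t)).map y A := by
    rw [Measure.map_apply hy hA, ← Measure.restrict_congr_set Ioo_ae_eq_Icc.symm,
      Measure.restrict_apply (hy hA), inter_comm]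
    rfl
  rw [hvol, hμν, hν, withDensity_apply _ hA,
    ofReal_integral_eq_lintegral_ofReal hli.integrableOn (ae_of_all _ hl0)]

end

theorem abs_smoothOcc_sub_le {d : ℕ} {y : ℝ → Ed d} (hy : Measurable y) {T : ℝ} (n : ℕ)
    (x z : Ed d) {s t : ℝ} (hs : s ∈ Icc 0 T) (ht : t ∈ Icc 0 T) :
    |smoothOcc y n x s - smoothOcc y n z t| ≤
      √Real.pi ^ d * (Real.pi * T + 1) * ((2 : ℝ) ^ (d + 1)) ^ n * (‖x - z‖ + |s - t|) := by
  have hT : 0 ≤ T := hs.1.trans hs.2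
  have h2n : (0 : ℝ) ≤ 2 ^ n := by positivity
  have hi : ∀ (x : Ed d) (a b : ℝ), IntegrableOn (fun r => gaussKernel (2 ^ n) (y r - x)) (Ioo a b) :=
    fun x a b => integrableOn_gaussKernel_path hy _ h2n x a b
  have h1 : |smoothOcc y n x s - smoothOcc y n z s| ≤
      (√Real.pi * 2 ^ n) ^ d * (Real.pi * 2 ^ n) * ‖x - z‖ * T := by
    rw [smoothOcc, smoothOcc, ← integral_sub (hi x 0 s) (hi z 0 s), ← Real.norm_eq_abs]
    refine (norm_setIntegral_le_of_norm_le_const (by simp)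
      (C := (√Real.pi * 2 ^ n) ^ d * (Real.pi * 2 ^ n) * ‖x - z‖) fun r _ => ?_).trans ?_
    · refine (abs_gaussKernel_sub_le h2n _ _).trans (le_of_eq ?_)
      rw [sub_sub_sub_cancel_left, norm_sub_rev]
    · rw [Real.volume_real_Ioo_of_le hs.1]
      gcongr
      linarith [hs.2]
  have h2 : |smoothOcc y n z s - smoothOcc y n z t| ≤ (√Real.pi * 2 ^ n) ^ d * |s - t| := by
    have hI : ∀ u, 0 ≤ u → smoothOcc y n z u = ∫ r in (0 : ℝ)..u, gaussKernel (2 ^ n) (y r - z) := by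
      intro u hu
      rw [intervalIntegral.integral_of_le hu, integral_Ioc_eq_integral_Ioo, smoothOcc]
    have hII : ∀ u, 0 ≤ u →
        IntervalIntegrable (fun r => gaussKernel (2 ^ n) (y r - z)) volume 0 u := by
      intro u hu
      rw [intervalIntegrable_iff_integrableOn_Ioo_of_le hu]
      exact hi z 0 u
    rw [hI s hs.1, hI t ht.1, intervalIntegral.integral_interval_sub_left (hII s hs.1) (hII t ht.1),
      ← Real.norm_eq_abs]
    refine intervalIntegral.norm_integral_le_of_norm_le_const fun r _ => ?_
    rw [Real.norm_of_nonneg (gaussKernel_nonneg h2n _)]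
    exact gaussKernel_le h2n _
  have e1 : (√Real.pi * 2 ^ n) ^ d * (Real.pi * 2 ^ n) =
      √Real.pi ^ d * Real.pi * ((2 : ℝ) ^ (d + 1)) ^ n := by
    rw [mul_pow, ← pow_mul, ← pow_mul, mul_comm (d + 1), mul_add, pow_add, mul_one]
    ring
  have e2 : (√Real.pi * 2 ^ n) ^ d ≤ √Real.pi ^ d * ((2 : ℝ) ^ (d + 1)) ^ n := by
    rw [mul_pow, ← pow_mul, ← pow_mul]
    exact mul_le_mul_of_nonneg_left (pow_le_pow_right₀ (by norm_num) (by nlinarith)) (by positivity)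
  rw [e1] at h1
  have h3 : |smoothOcc y n z s - smoothOcc y n z t| ≤
      √Real.pi ^ d * ((2 : ℝ) ^ (d + 1)) ^ n * |s - t| := h2.trans (by gcongr)
  have h4 := abs_sub_le (smoothOcc y n x s) (smoothOcc y n z s) (smoothOcc y n z t)
  have h5 : 0 ≤ √Real.pi ^ d * ((2 : ℝ) ^ (d + 1)) ^ n * ‖x - z‖ := by positivity
  have h6 : 0 ≤ √Real.pi ^ d * ((2 : ℝ) ^ (d + 1)) ^ n * |s - t| * (Real.pi * T) := by positivity
  nlinarith

theorem abs_smoothOcc_zero_le {d : ℕ} {y : ℝ → Ed d} {T : ℝ} (x : Ed d) {t : ℝ}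
    (ht : t ∈ Icc 0 T) : |smoothOcc y 0 x t| ≤ √Real.pi ^ d * T := by
  rw [smoothOcc, ← Real.norm_eq_abs]
  refine (norm_setIntegral_le_of_norm_le_const (by simp) (C := √Real.pi ^ d) fun r _ => ?_).trans ?_
  · rw [Real.norm_of_nonneg (gaussKernel_nonneg (by positivity) _)]
    have := gaussKernel_le (s := (2 : ℝ) ^ 0) (by positivity) (y r - x)
    rw [pow_zero, mul_one] at this
    rwa [pow_zero]
  · rw [Real.volume_real_Ioo_of_le ht.1]
    gcongr
    linarith [ht.2]

theorem measurable_smoothOcc {Ω : Type*} [MeasurableSpace Ω] {d : ℕ} {Y : ℝ → Ω → Ed d}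
    (hY : Measurable (Function.uncurry Y)) (n : ℕ) (x : Ed d) (t : ℝ) :
    Measurable fun ω => smoothOcc (fun r => Y r ω) n x t := by
  refine (StronglyMeasurable.integral_prod_right
    (f := fun (ω : Ω) (r : ℝ) => gaussKernel (2 ^ n) (Y r ω - x)) ?_).measurable
  refine Measurable.stronglyMeasurable ?_
  have h1 := (continuous_gaussKernel (d := d) (2 ^ n)).measurable
  have h2 : Measurable fun p : Ω × ℝ => Y p.2 p.1 := hY.comp measurable_swap
  exact h1.comp (h2.sub_const x)

theorem ae_exists_smoothOcc_step_le {Ω : Type*} [MeasurableSpace Ω] {P : Measure Ω}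
    [IsProbabilityMeasure P] {d : ℕ} {Y : ℝ → Ω → Ed d} (hY : Measurable (Function.uncurry Y))
    {T α γ : ℝ} (hT : 0 ≤ T) (hα : 0 < α) (hγ0 : 0 < γ) (hγ1 : γ ≤ 1)
    (hαγ : α * (1 + 2 * γ) * d < 1)
    (hK : ∀ m : ℕ, 0 < m → ∃ K : ℝ, ∀ r : Fin m → ℝ, StrictMono r → (∀ j, 0 < r j) →
      (∀ j, r j < T) → ∀ u : Fin m → Ed d,
        ‖∫ ω, Complex.exp (Complex.I * Complex.ofReal (∑ j, 2 * Real.pi * ⟪u j, Y (r j) ω⟫)) ∂P‖ₑ ≤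
        ENNReal.ofReal K * ∏ j, ∏ l, decayProfile (gap r j ^ α) ((∑ i ∈ Finset.Ici j, u i) l)) :
    ∀ᵐ ω ∂P, ∀ R : ℕ, ∃ C : ℝ, 0 ≤ C ∧ ∀ n x, ‖x‖ ≤ R → ∀ t ∈ Icc 0 T,
      |smoothOcc (fun r => Y r ω) (n + 1) x t - smoothOcc (fun r => Y r ω) n x t| ≤
        C * ((1 / 2 : ℝ) ^ (γ / 2)) ^ n := by
  have hYω : ∀ ω, Measurable fun r => Y r ω := fun ω => hY.comp measurable_prodMk_right
  set M := √Real.pi ^ d * (Real.pi * T + 1)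
  have hM : 0 ≤ M := by positivity
  refine ae_exists_bound_of_moments (B := 2 ^ (d + 1)) (M := 2 * M * 2 ^ (d + 1)) hT
    (by positivity) (by positivity) (Real.rpow_lt_one (by norm_num) (by norm_num) (by positivity))
    (by positivity)
    (D := fun n ω x t => smoothOcc (fun r => Y r ω) (n + 1) x t - smoothOcc (fun r => Y r ω) n x t)
    (fun n x t => (measurable_smoothOcc hY _ x t).sub (measurable_smoothOcc hY _ x t)) ?_ ?_
  · intro k hk
    obtain ⟨K, hKb⟩ := hK (2 * k) (by omega)
    obtain ⟨C, hC, hCb⟩ := moment_bound (even_two_mul k) hY hα hγ0.le hγ1 hαγ hKb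
    refine ⟨C, hC, fun n x t ht => ?_⟩
    have hs : (0 : ℝ) < 2 ^ n := by positivity
    have := hCb (ENNReal.ofReal ((1 / 2 ^ n) ^ γ))
      (fun y => gaussKernel (2 * 2 ^ n) (y - x) - gaussKernel (2 ^ n) (y - x))
      (gaussDiffFourier (2 ^ n) x)
      (((continuous_gaussKernel _).comp (continuous_id.sub continuous_const)).sub
        ((continuous_gaussKernel _).comp (continuous_id.sub continuous_const))).measurable
      (integrable_gaussDiffFourier hs x) (fun y => gaussKernel_sub_eq_integral hs x y)
      (fun w => enorm_gaussDiffFourier_le hs hγ0.le hγ1 x w) t ht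
    have e : (((1 / 2 : ℝ) ^ (γ / 2)) ^ 2) ^ n = (1 / 2 ^ n) ^ γ := by
      rw [← Real.rpow_mul_natCast (by norm_num), ← one_div_pow, Real.rpow_pow_comm (by norm_num)]
      congr 1
      push_cast
      ring
    rw [e]
    refine le_trans (le_of_eq ?_) this
    congr 1 with ω
    rw [smoothOcc, smoothOcc, ← integral_sub
      (integrableOn_gaussKernel_path (hYω ω) _ (by positivity) x 0 t)
      (integrableOn_gaussKernel_path (hYω ω) _ (by positivity) x 0 t), pow_succ']
  · intro n ω x y s hs t ht
    have h1 : _ ≤ M * _ * _ := abs_smoothOcc_sub_le (hYω ω) (n + 1) x y hs ht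
    have h2 : _ ≤ M * _ * _ := abs_smoothOcc_sub_le (hYω ω) n x y hs ht
    have h3 := abs_sub (smoothOcc (fun r => Y r ω) (n + 1) x s - smoothOcc (fun r => Y r ω) (n + 1) y t)
      (smoothOcc (fun r => Y r ω) n x s - smoothOcc (fun r => Y r ω) n y t)
    rw [sub_sub_sub_comm]
    have h4 : M * ((2 : ℝ) ^ (d + 1)) ^ n * (‖x - y‖ + |s - t|) ≤
        M * ((2 : ℝ) ^ (d + 1)) ^ (n + 1) * (‖x - y‖ + |s - t|) := by
      gcongr
      · exact one_le_pow₀ (by norm_num)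
      · omega
    rw [pow_succ ((2 : ℝ) ^ (d + 1)) n] at h1 h4
    rw [Nat.cast_pow, Nat.cast_ofNat]
    linarith

theorem exists_holder_density_of_step_le {d : ℕ} {y : ℝ → Ed d} (hy : Measurable y)
    {T ρ lam : ℝ} (hρ0 : 0 < ρ) (hρ1 : ρ < 1) (hl0 : 0 < lam) (hl1 : lam < 1)
    (hlam : ρ ^ (1 - lam) * ((2 : ℝ) ^ (d + 1)) ^ lam < 1)
    (hstep : ∀ R : ℕ, ∃ C : ℝ, 0 ≤ C ∧ ∀ n x, ‖x‖ ≤ R → ∀ t ∈ Icc 0 T,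
      |smoothOcc y (n + 1) x t - smoothOcc y n x t| ≤ C * ρ ^ n) :
    ∃ l : Ed d → ℝ → ℝ,
      (∀ t ∈ Icc 0 T, ∀ A : Set (Ed d), MeasurableSet A →
        volume (Icc 0 t ∩ {r | y r ∈ A}) = ENNReal.ofReal (∫ x in A, l x t)) ∧
      ∀ R : ℕ, ∃ η : ℝ, ∀ x z, ‖x‖ ≤ R → ‖z‖ ≤ R → ∀ s ∈ Icc 0 T, ∀ t ∈ Icc 0 T,
        |l x t - l z s| ≤ η * (‖x - z‖ ^ lam + |t - s| ^ lam) := by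
  let l : Ed d → ℝ → ℝ := fun x t => limUnder atTop fun n => smoothOcc y n x t
  have hdist : ∀ {C : ℝ} {x : Ed d} {t : ℝ},
      (∀ n, |smoothOcc y (n + 1) x t - smoothOcc y n x t| ≤ C * ρ ^ n) →
      ∀ n, dist (smoothOcc y n x t) (smoothOcc y (n + 1) x t) ≤ C * ρ ^ n := by
    intro C x t h n
    rw [dist_comm, Real.dist_eq]
    exact h n
  have hlim : ∀ x, ∀ t ∈ Icc 0 T, Tendsto (fun n => smoothOcc y n x t) atTop (𝓝 (l x t)) := by
    intro x t ht
    obtain ⟨R, hR⟩ := exists_nat_ge ‖x‖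
    obtain ⟨C, -, hC⟩ := hstep R
    exact (cauchySeq_of_le_geometric ρ C hρ1 (hdist fun n => hC n x hR t ht)).tendsto_limUnder
  have hholder : ∀ R : ℕ, ∃ η : ℝ, ∀ x z, ‖x‖ ≤ R → ‖z‖ ≤ R → ∀ s ∈ Icc 0 T, ∀ t ∈ Icc 0 T,
      |l x t - l z s| ≤ η * (‖x - z‖ ^ lam + |t - s| ^ lam) := by
    intro R
    rcases lt_or_ge T 0 with hT | hT
    · exact ⟨0, fun x z _ _ s hs => absurd (hs.1.trans hs.2) (not_le.2 hT)⟩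
    obtain ⟨C, hC0, hC⟩ := hstep R
    obtain ⟨η, hη0, hη⟩ := exists_holder_of_geometric_approx
      (S := {p : Ed d × ℝ | ‖p.1‖ ≤ R ∧ p.2 ∈ Icc 0 T})
      (δ := fun p q => ‖p.1 - q.1‖ + |p.2 - q.2|) (fun p q => by positivity)
      (L := fun n p => smoothOcc y n p.1 p.2) (l := fun p => l p.1 p.2)
      (B := 2 ^ (d + 1)) (M := √Real.pi ^ d * (Real.pi * T + 1)) (C₀ := √Real.pi ^ d * T)
      (fun p hp => hlim p.1 p.2 hp.2) hρ0 (one_le_pow₀ (by norm_num)) (by positivity)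
      (by positivity) hC0 hl0 hl1 hlam (fun p hp => abs_smoothOcc_zero_le p.1 hp.2)
      (fun n p hp => hC n p.1 hp.1 p.2 hp.2)
      (fun n p hp q hq => abs_smoothOcc_sub_le hy n p.1 q.1 hp.2 hq.2)
    refine ⟨η, fun x z hx hz s hs t ht => (hη (x, t) ⟨hx, ht⟩ (z, s) ⟨hz, hs⟩).trans ?_⟩
    gcongr
    exact rpow_add_le_add_rpow (norm_nonneg _) (abs_nonneg _) hl0.le hl1.le
  refine ⟨l, fun t ht A hA => ?_, hholder⟩
  have hcont : Continuous fun x => l x t := by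
    rw [continuous_iff_continuousAt]
    intro x
    obtain ⟨R, hR⟩ := exists_nat_ge (‖x‖ + 1)
    obtain ⟨η, hη⟩ := hholder R
    rw [ContinuousAt, tendsto_iff_norm_sub_tendsto_zero]
    have hb : ∀ᶠ z in 𝓝 x, ‖l z t - l x t‖ ≤ η * ‖z - x‖ ^ lam := by
      filter_upwards [Metric.ball_mem_nhds x one_pos] with z hz
      rw [mem_ball_iff_norm] at hz
      have hz' : ‖z‖ ≤ R := by linarith [norm_le_norm_add_norm_sub' z x]
      have := hη z x hz' (by linarith) t ht t ht
      rwa [sub_self, abs_zero, Real.zero_rpow hl0.ne', add_zero] at this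
    refine squeeze_zero' (Eventually.of_forall fun _ => norm_nonneg _) hb ?_
    have : Continuous fun z => η * ‖z - x‖ ^ lam :=
      continuous_const.mul ((by fun_prop : Continuous fun z => ‖z - x‖).rpow_const
        fun _ => Or.inr hl0.le)
    simpa [Real.zero_rpow hl0.ne'] using this.tendsto x
  refine occupation_eq_of_tendsto hy hρ0.le hρ1 hcont (fun R => ?_) hA
  obtain ⟨C, -, hC⟩ := hstep R
  refine ⟨C / (1 - ρ), fun n x hx => ?_⟩
  have := dist_le_of_le_geometric_of_tendsto ρ C hρ1 (hdist fun n => hC n x hx t ht) (hlim x t ht) n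
  rw [Real.dist_eq] at this
  refine this.trans (le_of_eq ?_)
  ring

theorem exists_continuous_modification {Ω : Type*} [MeasurableSpace Ω] {P : Measure Ω} {d : ℕ}
    {T : ℝ} (hT : 0 ≤ T) {X : ℝ → Ω → Ed d} (hmeas : ∀ t, Measurable (X t))
    (hpath : ∀ᵐ ω ∂P, ContinuousOn (fun u => X u ω) (Icc 0 T)) :
    ∃ Y : ℝ → Ω → Ed d, Measurable (Function.uncurry Y) ∧
      ∀ᵐ ω ∂P, ∀ r ∈ Icc 0 T, Y r ω = X r ω - X 0 ω := by
  obtain ⟨N, hsub, hN, hN0⟩ := exists_measurable_superset_of_null (ae_iff.1 hpath)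
  have h0 : (0 : ℝ) ∈ Icc 0 T := ⟨le_rfl, hT⟩
  let Z : ℝ → Ω → Ed d := fun r => Nᶜ.indicator fun ω => X (projIcc 0 T hT r) ω - X 0 ω
  have hZ : ∀ ω ∉ N, ∀ r, Z r ω = X (projIcc 0 T hT r) ω - X 0 ω := fun ω hω r =>
    indicator_of_mem (show ω ∈ Nᶜ from hω) _
  have hmeasZ : ∀ r, Measurable (Z r) := fun r => ((hmeas _).sub (hmeas 0)).indicator hN.compl
  have hcontZ : ∀ ω, Continuous fun r => Z r ω := by
    intro ω
    by_cases hω : ω ∈ N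
    · have : (fun r => Z r ω) = fun _ => 0 :=
        funext fun r => indicator_of_notMem (show ω ∉ Nᶜ from fun h => h hω) _
      rw [this]
      exact continuous_const
    · have hc : ContinuousOn (fun u => X u ω) (Icc 0 T) := by
        by_contra h
        exact hω (hsub h)
      simp only [hZ ω hω]
      exact (continuousOn_iff_continuous_domRestrict.1 hc |>.comp continuous_projIcc).sub
        continuous_const
  refine ⟨Z, ?_, ?_⟩
  · exact measurable_uncurry_of_continuous_of_measurable hcontZ hmeasZ
  · filter_upwards [compl_mem_ae_iff.2 hN0] with ω hω r hr
    rw [hZ ω hω r, projIcc_of_mem hT hr]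

theorem occupation_translate {d : ℕ} {x y : ℝ → Ed d} {l : Ed d → ℝ} {T t : ℝ} {c : Ed d}
    (ht : t ∈ Icc 0 T) (hxy : ∀ r ∈ Icc 0 T, y r = x r - c)
    (hl : ∀ A : Set (Ed d), MeasurableSet A →
      volume (Icc 0 t ∩ {r | y r ∈ A}) = ENNReal.ofReal (∫ z in A, l z))
    {A : Set (Ed d)} (hA : MeasurableSet A) :
    volume (Icc 0 t ∩ {r | x r ∈ A}) = ENNReal.ofReal (∫ z in A, l (z - c)) := by
  have h1 : Icc 0 t ∩ {r | x r ∈ A} = Icc 0 t ∩ {r | y r ∈ (· + c) ⁻¹' A} := by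
    ext r
    refine and_congr_right fun hr => ?_
    rw [mem_ofPred, mem_ofPred, mem_preimage, hxy r ⟨hr.1, hr.2.trans ht.2⟩, sub_add_cancel]
  rw [h1, hl _ (measurable_add_const c hA)]
  congr 1
  rw [← (measurePreserving_add_right volume c).setIntegral_preimage_emb
    (measurableEmbedding_addRight c) (fun z => l (z - c)) A]
  simp

theorem exists_pos_le_one_mul_lt_one {a : ℝ} (ha0 : 0 < a) (ha1 : a < 1) :
    ∃ γ : ℝ, 0 < γ ∧ γ ≤ 1 ∧ a * (1 + 2 * γ) < 1 := by
  refine ⟨min 1 ((1 / a - 1) / 4), lt_min one_pos ?_, min_le_left _ _, ?_⟩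
  · have := one_lt_one_div ha0 ha1
    linarith
  · have h : a * min 1 ((1 / a - 1) / 4) ≤ a * ((1 / a - 1) / 4) := by
      gcongr
      exact min_le_right _ _
    have e : a * ((1 / a - 1) / 4) = (1 - a) / 4 := by field_simp
    nlinarith

/-- Corollary cor:holder: under (A1) and (A2), there exist exponents
`β₁, β₂ > 0` and a version `L̃` of the local time which is almost surely jointly Hölder
continuous in `(x,t)`: on every compact `K ⊆ ℝ^d` there is a random constant `η` with
`|L̃(x,t) - L̃(y,s)| ≤ η (‖x-y‖^{β₁} + |t-s|^{β₂})` for `x,y ∈ K`, `s,t ∈ [0,T]`. -/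
theorem localTime_jointly_holder
    {Ω : Type*} [MeasurableSpace Ω] (P : Measure Ω) [IsProbabilityMeasure P]
    {d : ℕ} (hd : 0 < d) (T : ℝ) (hT : 0 < T)
    (X : ℝ → Ω → Ed d) (hmeas : ∀ t : ℝ, Measurable (X t))
    (hpath : ∀ᵐ ω ∂P, ContinuousOn (fun u => X u ω) (Icc 0 T))
    (α θ ι : ℝ) (hα : 0 < α) (hαd : α < 1 / d) (hθ : 0 ≤ θ) (hι : ι ∈ Icc (0 : ℝ) 1)
    (hA1 : CondA1 P X T α θ) (hA2 : CondA2 P X T α ι) :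
    ∃ β₁ β₂ : ℝ, 0 < β₁ ∧ 0 < β₂ ∧ ∃ L : Ed d → ℝ → Ω → ℝ,
      (∀ᵐ ω ∂P, ∀ t ∈ Icc (0 : ℝ) T, ∀ A : Set (Ed d), MeasurableSet A →
        volume (Icc 0 t ∩ {u | X u ω ∈ A}) = ENNReal.ofReal (∫ x in A, L x t ω)) ∧
      (∀ᵐ ω ∂P, ∀ K : Set (Ed d), IsCompact K → ∃ η : ℝ,
        ∀ x ∈ K, ∀ y ∈ K, ∀ s ∈ Icc (0 : ℝ) T, ∀ t ∈ Icc (0 : ℝ) T,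
          |L x t ω - L y s ω| ≤ η * (‖x - y‖ ^ β₁ + |t - s| ^ β₂)) := by
  have hd' : (0 : ℝ) < d := by exact_mod_cast hd
  obtain ⟨γ, hγ0, hγ1, hγ⟩ := exists_pos_le_one_mul_lt_one (mul_pos hα hd')
    ((lt_div_iff₀ hd').1 hαd)
  obtain ⟨Y, hY, hYX⟩ := exists_continuous_modification hT.le hmeas hpath
  have hρ0 : (0 : ℝ) < (1 / 2) ^ (γ / 2) := by positivity
  have hρ1 : (1 / 2 : ℝ) ^ (γ / 2) < 1 :=
    Real.rpow_lt_one (by norm_num) (by norm_num) (by positivity)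
  obtain ⟨lam, hl0, hl1, hlam⟩ := exists_rpow_mul_rpow_lt_one (B := (2 : ℝ) ^ (d + 1)) hρ0 hρ1
    (by positivity)
  have hstep := ae_exists_smoothOcc_step_le (P := P) hY hT.le hα hγ0 hγ1
    (by linarith [hγ, mul_right_comm α (d : ℝ) (1 + 2 * γ)]) fun m hm => by
      obtain ⟨K, -, hK⟩ := hA1.charFun_bound hm
      refine ⟨K, fun r hr h0 hrT u => le_of_eq_of_le ?_ (hK r hr h0 hrT u)⟩
      congr 1
      refine integral_congr_ae ?_
      filter_upwards [hYX] with ω hω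
      simp only [hω _ ⟨(h0 _).le, (hrT _).le⟩]
  have hdens : ∀ᵐ ω ∂P, ∃ l : Ed d → ℝ → ℝ,
      (∀ t ∈ Icc 0 T, ∀ A : Set (Ed d), MeasurableSet A →
        volume (Icc 0 t ∩ {r | Y r ω ∈ A}) = ENNReal.ofReal (∫ x in A, l x t)) ∧
      ∀ R : ℕ, ∃ η : ℝ, ∀ x z, ‖x‖ ≤ R → ‖z‖ ≤ R → ∀ s ∈ Icc 0 T, ∀ t ∈ Icc 0 T,
        |l x t - l z s| ≤ η * (‖x - z‖ ^ lam + |t - s| ^ lam) := by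
    filter_upwards [hstep] with ω hω
    exact exists_holder_density_of_step_le (hY.comp measurable_prodMk_right) hρ0 hρ1 hl0 hl1 hlam hω
  obtain ⟨l, hl⟩ := hdens.choice
  refine ⟨lam, lam, hl0, hl0, fun x t ω => l ω (x - X 0 ω) t, ?_, ?_⟩
  · filter_upwards [hl, hYX] with ω hω hYω t ht A hA
    exact occupation_translate ht hYω (hω.1 t ht) hA
  · filter_upwards [hl] with ω hω K hK
    obtain ⟨R₀, hR₀⟩ := hK.isBounded.exists_norm_le
    obtain ⟨R, hR⟩ := exists_nat_ge (R₀ + ‖X 0 ω‖)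
    obtain ⟨η, hη⟩ := hω.2 R
    have hball : ∀ x ∈ K, ‖x - X 0 ω‖ ≤ R := fun x hx =>
      (norm_sub_le _ _).trans ((add_le_add_left (hR₀ x hx) _).trans hR)
    refine ⟨η, fun x hx y hy s hs t ht => ?_⟩
    simpa only [sub_sub_sub_cancel_right] using
      hη (x - X 0 ω) (y - X 0 ω) (hball x hx) (hball y hy) s hs t ht
end
end

section
/- Let Z = (Z_t)_{t∈[0,T]} be a real-valued centered Gaussian process, in the sense that for every m ∈ ℕ, all real coefficients ξ_1, …, ξ_m and all times 0 = t_0 < t_1 < … < t_m ≤ T, the law of S = Σ_{k=1}^m ξ_k (Z_{t_k} − Z_{t_{k−1}}) is the centered Gaussian law with variance Var(S) = E[S²]. Suppose there are constants C₋, C₊ > 0 and H ∈ (0,1) with C₋ |t − s|^{2H} ≤ E[(Z_t − Z_s)²] ≤ C₊ |t − s|^{2H} for all s, t ∈ [0,T], and suppose the local non-determinism property holds: there is a constant c > 0 such that E[ ( Σ_{k=1}^m ξ_k (Z_{t_k} − Z_{t_{k−1}}) )² ] ≥ c Σ_{k=1}^m ξ_k² E[(Z_{t_k} − Z_{t_{k−1}})²]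 for all m ∈ ℕ, all ξ_k ∈ ℝ and all 0 = t_0 < t_1 < … < t_m ≤ T. Then condition (A1) holds with α = H, θ = 0 and d = 1: there exists a constant C > 0 such that for every m ∈ ℕ, all ξ_j ∈ ℝ∖{0}, all 0 = t_0 < t_1 < … < t_m < T and every choice of exponents k_j ∈ {0,4}, |E[exp(i Σ_{j=1}^m ξ_j (Z_{t_j} − Z_{t_{j−1}}))]| ≤ C^m ∏_{j=1}^m |ξ_j|^{−k_j} (t_j − t_{j−1})^{−H k_j}. -/
open MeasureTheory Filter Topology Set ProbabilityTheory

noncomputable section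

/-- The quadratic exponential decay dominates any power of order `0` or `4`. -/
lemma exp_neg_mul_sq_le_mul_inv_pow {a x : ℝ} (ha : 0 < a) (hx : 0 < x) {n : ℕ}
    (hn : n = 0 ∨ n = 4) :
    Real.exp (-(a * x ^ 2)) ≤ (1 + 2 / a ^ 2) * (x ^ n)⁻¹ := by
  have hpos : 0 < 2 / a ^ 2 := by positivity
  rcases hn with rfl | rfl
  · have : Real.exp (-(a * x ^ 2)) ≤ 1 := Real.exp_le_one_iff.2 (by nlinarith [sq_nonneg x])
    simp only [pow_zero, inv_one, mul_one]
    linarith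
  · have hy : 0 < a * x ^ 2 := by positivity
    have hq : (a * x ^ 2) ^ 2 / 2 ≤ Real.exp (a * x ^ 2) := by
      have := Real.quadratic_le_exp_of_nonneg hy.le
      linarith
    calc Real.exp (-(a * x ^ 2)) = (Real.exp (a * x ^ 2))⁻¹ := Real.exp_neg _
      _ ≤ ((a * x ^ 2) ^ 2 / 2)⁻¹ := inv_anti₀ (by positivity) hq
      _ = 2 / a ^ 2 * (x ^ 4)⁻¹ := by field_simp
      _ ≤ (1 + 2 / a ^ 2) * (x ^ 4)⁻¹ := by gcongr; linarith

/-- The modulus of `E[exp(iS)]` for a centered Gaussian variable `S` with variance `v`. -/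
lemma norm_integral_cexp_I_mul_of_map_eq_gaussianReal {Ω : Type*} [MeasurableSpace Ω]
    {P : Measure Ω} {S : Ω → ℝ} (hS : AEMeasurable S P) {v : NNReal}
    (h : Measure.map S P = gaussianReal 0 v) :
    ‖∫ ω, Complex.exp (Complex.I * Complex.ofReal (S ω)) ∂P‖ = Real.exp (-(v / 2 : ℝ)) := by
  have hchar : ∫ ω, Complex.exp (Complex.I * Complex.ofReal (S ω)) ∂P
      = charFun (Measure.map S P) 1 := by
    rw [charFun_apply_real, integral_map hS (by fun_prop)]
    simp [mul_comm]
  rw [hchar, h, charFun_gaussianReal, Complex.norm_exp]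
  simp

/-- Proposition main4 for `d = 1`: a centered real Gaussian process whose
increment variances are comparable to `|t-s|^{2H}` and which is locally nondeterministic
satisfies condition (A1) with `α = H`, `θ = 0` and `d = 1`. -/
theorem gaussian_LND_satisfies_A1
    {Ω : Type*} [MeasurableSpace Ω] (P : Measure Ω) [IsProbabilityMeasure P]
    (T : ℝ) (hT : 0 < T)
    (Z : ℝ → Ω → ℝ) (hmeas : ∀ t : ℝ, Measurable (Z t))
    (H : ℝ) (hH0 : 0 < H) (hH1 : H < 1)
    (hGauss : ∀ m : ℕ, 0 < m → ∀ ξ : Fin m → ℝ,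
      ∀ t : Fin (m + 1) → ℝ, StrictMono t → t 0 = 0 → t (Fin.last m) ≤ T →
        Measure.map
            (fun ω => ∑ k, ξ k * (Z (t k.succ) ω - Z (t k.castSucc) ω)) P =
          gaussianReal 0
            (Real.toNNReal
              (∫ ω, (∑ k, ξ k * (Z (t k.succ) ω - Z (t k.castSucc) ω)) ^ 2 ∂P)))
    (Cm Cp : ℝ) (hCm : 0 < Cm) (hCp : 0 < Cp)
    (hvar : ∀ s ∈ Icc (0 : ℝ) T, ∀ t ∈ Icc (0 : ℝ) T,
      Cm * |t - s| ^ (2 * H) ≤ ∫ ω, (Z t ω - Z s ω) ^ 2 ∂P ∧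
        ∫ ω, (Z t ω - Z s ω) ^ 2 ∂P ≤ Cp * |t - s| ^ (2 * H))
    (c : ℝ) (hc : 0 < c)
    (hLND : ∀ m : ℕ, 0 < m → ∀ ξ : Fin m → ℝ,
      ∀ t : Fin (m + 1) → ℝ, StrictMono t → t 0 = 0 → t (Fin.last m) ≤ T →
        c * ∑ k, (ξ k) ^ 2 * ∫ ω, (Z (t k.succ) ω - Z (t k.castSucc) ω) ^ 2 ∂P ≤
          ∫ ω, (∑ k, ξ k * (Z (t k.succ) ω - Z (t k.castSucc) ω)) ^ 2 ∂P) :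
    ∃ C : ℝ, 0 < C ∧
      ∀ m : ℕ, 0 < m → ∀ ξ : Fin m → ℝ, (∀ j, ξ j ≠ 0) →
        ∀ t : Fin (m + 1) → ℝ, StrictMono t → t 0 = 0 → t (Fin.last m) < T →
          ∀ k : Fin m → ℕ, (∀ j, k j = 0 ∨ k j = 4) →
            ‖∫ ω, Complex.exp (Complex.I * Complex.ofReal
                (∑ j, ξ j * (Z (t j.succ) ω - Z (t j.castSucc) ω))) ∂P‖ ≤
              C ^ m * ∏ j, (|ξ j| ^ (k j))⁻¹ *
                ((t j.succ - t j.castSucc) ^ (H * (k j : ℝ)))⁻¹ := by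
  set a : ℝ := c * Cm / 2 with ha_def
  have ha : 0 < a := by positivity
  refine ⟨1 + 2 / a ^ 2, by positivity, ?_⟩
  intro m hm ξ hξ t ht ht0 htT k hk
  have hmem : ∀ i, t i ∈ Icc (0 : ℝ) T := fun i =>
    ⟨ht0 ▸ ht.monotone (Fin.zero_le i), (ht.monotone (Fin.le_last i)).trans htT.le⟩
  have hΔ : ∀ j : Fin m, 0 < t j.succ - t j.castSucc := fun j =>
    sub_pos.2 (ht Fin.castSucc_lt_succ)
  set x : Fin m → ℝ := fun j => |ξ j| * (t j.succ - t j.castSucc) ^ H with hx_def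
  have hx : ∀ j, 0 < x j := fun j =>
    mul_pos (abs_pos.2 (hξ j)) (Real.rpow_pos_of_pos (hΔ j) H)
  have hxsq : ∀ j, Cm * x j ^ 2 ≤
      ξ j ^ 2 * ∫ ω, (Z (t j.succ) ω - Z (t j.castSucc) ω) ^ 2 ∂P := by
    intro j
    have h1 := (hvar _ (hmem j.castSucc) _ (hmem j.succ)).1
    have h2 : x j ^ 2 = ξ j ^ 2 * |t j.succ - t j.castSucc| ^ (2 * H) := by
      rw [hx_def, abs_of_pos (hΔ j), mul_comm 2 H, Real.rpow_mul (hΔ j).le]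
      simp [mul_pow]
    calc Cm * x j ^ 2 = ξ j ^ 2 * (Cm * |t j.succ - t j.castSucc| ^ (2 * H)) := by
          rw [h2]; ring
      _ ≤ _ := by gcongr
  have hV := hLND m hm ξ t ht ht0 htT.le
  rw [norm_integral_cexp_I_mul_of_map_eq_gaussianReal (by fun_prop)
    (hGauss m hm ξ t ht ht0 htT.le), Real.coe_toNNReal _ (by positivity)]
  have hsum : c * ∑ j, Cm * x j ^ 2 ≤
      ∫ ω, (∑ k, ξ k * (Z (t k.succ) ω - Z (t k.castSucc) ω)) ^ 2 ∂P :=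
    (mul_le_mul_of_nonneg_left (Finset.sum_le_sum fun j _ => hxsq j) hc.le).trans hV
  calc _ ≤ Real.exp (∑ j, -(a * x j ^ 2)) := by
        refine Real.exp_le_exp.2 ?_
        rw [Finset.sum_neg_distrib, ← Finset.mul_sum, ha_def]
        rw [← Finset.mul_sum] at hsum
        linarith
    _ = ∏ j, Real.exp (-(a * x j ^ 2)) := Real.exp_sum _ _
    _ ≤ ∏ j, (1 + 2 / a ^ 2) * (x j ^ k j)⁻¹ :=
        Finset.prod_le_prod (fun _ _ => (Real.exp_pos _).le)
          fun j _ => exp_neg_mul_sq_le_mul_inv_pow ha (hx j) (hk j)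
    _ = _ := by
        rw [Finset.prod_mul_distrib]
        simp only [Finset.prod_const, Finset.card_univ, Fintype.card_fin]
        congr 1
        refine Finset.prod_congr rfl fun j _ => ?_
        rw [hx_def, mul_pow, mul_inv, Real.rpow_mul (hΔ j).le, Real.rpow_natCast]
end
end
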